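/- arXiv:1702.02115 — 2 statements merged into one kernel-verified Lean document; each statement's English description precedes it below -/
import Mathlib

section
/- Let p, q be polynomials with complex coefficients and ε ∈ ℂ. For s ∈ ℂ∖{0} define f_s(z,w) := (p(z) + sεw, q(w)), φ_s(z,w) := (sz, w) and g_s := φ_s⁻¹ ∘ f_s ∘ φ_s. Then for every k ≥ 1 there exists a polynomial R_k in three variables with complex coefficients (depending on p, q, ε, k but not on s) such that for all s ∈ ℂ∖{0} and all (z,w) ∈ ℂ², the second coordinate of g_s^k(z,w) is q^k(w) and its first coordinate equals s⁻¹·p^k(0) + z·∏_{i=0}^{k−1} p'(p^i(0)) + ε·Σ_{i=0}^{k−1} q^i(w)·∏_{j=i+1}^{k−1} p'(p^j(0)) + s·R_k(s,z,w). -/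
theorem taylor_two_aux (p : Polynomial ℂ) (a : ℂ) : ∃ T : Polynomial ℂ, ∀ y : ℂ,
    p.eval (a + y) = p.eval a + p.derivative.eval a * y + y ^ 2 * T.eval y := by
  refine ⟨(Polynomial.taylor a p).divX.divX, fun y => ?_⟩
  have h1 := congrArg (Polynomial.eval y) (Polynomial.divX_mul_X_add (Polynomial.taylor a p))
  have h2 := congrArg (Polynomial.eval y) (Polynomial.divX_mul_X_add (Polynomial.taylor a p).divX)
  simp only [Polynomial.eval_add, Polynomial.eval_mul, Polynomial.eval_X, Polynomial.eval_C,
    Polynomial.coeff_divX, Polynomial.taylor_coeff_zero, zero_add,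
    Polynomial.taylor_coeff_one, Polynomial.taylor_eval] at h1 h2
  rw [add_comm a y, ← h1, ← h2]
  ring

theorem eval_aeval_aux (v : Fin 3 → ℂ) (T : Polynomial ℂ) (M : MvPolynomial (Fin 3) ℂ) :
    MvPolynomial.eval v (Polynomial.aeval M T) = T.eval (MvPolynomial.eval v M) := by
  induction T using Polynomial.induction_on' with
  | add f g hf hg => simp [hf, hg]
  | monomial n c => simp [Polynomial.aeval_monomial, MvPolynomial.algebraMap_eq]


/-- The closed form for the `s⁻¹`- and `s⁰`-coefficients of the iterates of the renormalized
skew product `g_s = φ_s⁻¹ ∘ f_s ∘ φ_s`, where `f_s (z,w) = (p z + s ε w, q w)` and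
`φ_s (z,w) = (s z, w)`: the first coordinate of `g_s^k (z,w)` equals
`s⁻¹ p^k(0) + z ∏_{i<k} p'(p^i(0)) + ε ∑_{i<k} q^i(w) ∏_{j=i+1}^{k-1} p'(p^j(0)) + s R_k(s,z,w)`
for a polynomial `R_k` independent of `s`, and the second coordinate is `q^k(w)`. -/
theorem stmt_8 (p q : Polynomial ℂ) (ε : ℂ) (k : ℕ) (hk : 1 ≤ k) :
    ∃ R : MvPolynomial (Fin 3) ℂ,
      ∀ s : ℂ, s ≠ 0 → ∀ z w : ℂ,
        ((fun x : ℂ × ℂ => ((p.eval (s * x.1) + s * ε * x.2) / s, q.eval x.2))^[k]) (z, w) =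
          (s⁻¹ * (fun z => p.eval z)^[k] 0 +
            z * ∏ i ∈ Finset.range k, p.derivative.eval ((fun z => p.eval z)^[i] 0) +
            ε * ∑ i ∈ Finset.range k, (fun w => q.eval w)^[i] w *
              ∏ j ∈ Finset.Ico (i + 1) k, p.derivative.eval ((fun z => p.eval z)^[j] 0) +
            s * MvPolynomial.eval ![s, z, w] R,
          (fun w => q.eval w)^[k] w) := by
  clear hk
  induction k with
  | zero => exact ⟨0, fun s _ z w => by simp⟩
  | succ k ih =>
    obtain ⟨R, hR⟩ := ih
    obtain ⟨T, hT⟩ := taylor_two_aux p ((fun z => p.eval z)^[k] 0)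
    let M : MvPolynomial (Fin 3) ℂ :=
      MvPolynomial.X 1 * MvPolynomial.C
          (∏ i ∈ Finset.range k, p.derivative.eval ((fun z => p.eval z)^[i] 0)) +
        MvPolynomial.C ε * ∑ i ∈ Finset.range k,
          Polynomial.aeval (MvPolynomial.X 2) (q.comp^[i] Polynomial.X) *
            MvPolynomial.C
              (∏ j ∈ Finset.Ico (i + 1) k, p.derivative.eval ((fun z => p.eval z)^[j] 0)) +
        MvPolynomial.X 0 * R
    refine ⟨MvPolynomial.C (p.derivative.eval ((fun z => p.eval z)^[k] 0)) * R +
      M ^ 2 * Polynomial.aeval (MvPolynomial.X 0 * M) T, fun s hs z w => ?_⟩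
    have hM : MvPolynomial.eval ![s, z, w] M =
        z * ∏ i ∈ Finset.range k, p.derivative.eval ((fun z => p.eval z)^[i] 0) +
        ε * ∑ i ∈ Finset.range k, (fun w => q.eval w)^[i] w *
          ∏ j ∈ Finset.Ico (i + 1) k, p.derivative.eval ((fun z => p.eval z)^[j] 0) +
        s * MvPolynomial.eval ![s, z, w] R := by
      simp only [M, map_add, map_mul, map_sum, MvPolynomial.eval_X, MvPolynomial.eval_C,
        eval_aeval_aux, Polynomial.iterate_comp_eval, Polynomial.eval_X]
      rfl
    have hX : MvPolynomial.eval ![s, z, w] (MvPolynomial.X 0) = s := by simp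
    have hS : ∑ i ∈ Finset.range (k + 1), (fun w => q.eval w)^[i] w *
          ∏ j ∈ Finset.Ico (i + 1) (k + 1), p.derivative.eval ((fun z => p.eval z)^[j] 0) =
        (∑ i ∈ Finset.range k, (fun w => q.eval w)^[i] w *
          ∏ j ∈ Finset.Ico (i + 1) k, p.derivative.eval ((fun z => p.eval z)^[j] 0)) *
          p.derivative.eval ((fun z => p.eval z)^[k] 0) + (fun w => q.eval w)^[k] w := by
      rw [Finset.sum_range_succ, Finset.sum_mul]
      congr 1
      · refine Finset.sum_congr rfl fun i hi => ?_
        rw [Finset.prod_Ico_succ_top (by have := Finset.mem_range.1 hi; omega), mul_assoc]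
      · simp
    rw [Function.iterate_succ_apply', hR s hs z w, hS, Finset.prod_range_succ,
      Function.iterate_succ_apply', Function.iterate_succ_apply']
    simp only [map_add, map_mul, map_pow, MvPolynomial.eval_C, eval_aeval_aux, hX]
    generalize (∑ i ∈ Finset.range k, (fun w => q.eval w)^[i] w *
          ∏ j ∈ Finset.Ico (i + 1) k, p.derivative.eval ((fun z => p.eval z)^[j] 0)) = S at *
    generalize (∏ i ∈ Finset.range k, p.derivative.eval ((fun z => p.eval z)^[i] 0)) = P at *
    generalize (fun z => p.eval z)^[k] 0 = a at *
    generalize MvPolynomial.eval ![s, z, w] M = m at *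
    generalize MvPolynomial.eval ![s, z, w] R = r at *
    have h1 : s * (s⁻¹ * a + z * P + ε * S + s * r) = a + s * m := by
      rw [hM]; field_simp; ring
    rw [h1, hT]
    refine Prod.ext ?_ rfl
    simp only
    generalize T.eval (s * m) = t
    subst hM
    field_simp
    ring
end

section
/- Let d ≥ 2, m₀ ≥ 2 and m₁ := 3m₀. Let q be a polynomial of degree d, let ρ ∈ ℂ be a primitive third root of unity, and let b : ℤ → ℂ∖{0} satisfy b_{i−m₀} = ρ·bᵢ for all i ∈ ℤ. Define c(w) := Σ_{i=0}^{m₁−1} bᵢ·q^i(w). Then there exists r ∈ ℂ such that q^{m₁}(r) = r, |(q^{m₁})'(r)| > 1, r ∉ P(q), and c(r) ≠ 0. Moreover, setting r₁ := r, r₂ := q^{m₀}(r), r₃ := q^{2m₀}(r) and cⱼ := c(rⱼ), the points r₁, r₂, r₃ are pairwise distinct repelling fixed points of q^{m₁} lying outside P(q), and c₂ = ρ·c₁ and c₃ = ρ²·c₁, so that c₁, c₂, c₃ are not collinear and satisfy c₁ + c₂ + c₃ = 0 (they form a non-degenerate equilateral triangle). -/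
section Helpers

open Polynomial MeasureTheory Set
open scoped ENNReal Topology

lemma exists_inj_cover (q : ℂ[X]) :
    ∃ A : ℕ → Set ℂ, (∀ i, MeasurableSet (A i)) ∧ (∀ i, InjOn (fun w => q.eval w) (A i)) ∧
      Pairwise (Function.onFun Disjoint A) ∧ {w | q.derivative.eval w ≠ 0} ⊆ ⋃ i, A i := by
  have key : ∀ w : ℂ, ∃ U : Set ℂ, IsOpen U ∧ InjOn (fun w => q.eval w) U ∧
      (q.derivative.eval w ≠ 0 → w ∈ U) := by
    intro w
    by_cases hw : q.derivative.eval w = 0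
    · exact ⟨∅, isOpen_empty, by simp, fun h => absurd hw h⟩
    · have hs : HasStrictDerivAt (fun w => q.eval w) (q.derivative.eval w) w :=
        q.hasStrictDerivAt w
      have hs' := hs.hasStrictFDerivAt_equiv hw
      refine ⟨(hs'.toOpenPartialHomeomorph _).source, (hs'.toOpenPartialHomeomorph _).open_source,
        (hs'.toOpenPartialHomeomorph _).injOn, fun _ => hs'.mem_toOpenPartialHomeomorph_source⟩
  choose U hUo hUi hUm using key
  obtain ⟨T, hTc, hT⟩ := TopologicalSpace.isOpen_iUnion_countable U hUo
  have hTc' : (insert (q.derivative.roots.toFinset.toList.headD 0) T).Countable := hTc.insert _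
  obtain ⟨f, hf⟩ := hTc'.exists_eq_range (by simp)
  refine ⟨disjointed (fun n => U (f n)), ?_, ?_, disjoint_disjointed _, ?_⟩
  · intro i
    exact MeasurableSet.disjointed (fun n => (hUo (f n)).measurableSet) i
  · intro i
    exact (hUi (f i)).mono (disjointed_subset _ _)
  · rw [iUnion_disjointed]
    intro w hw
    have : w ∈ ⋃ i, U i := mem_iUnion.2 ⟨w, hUm w hw⟩
    rw [← hT] at this
    simp only [mem_iUnion] at this
    obtain ⟨i, hi, hwi⟩ := this
    have : i ∈ range f := hf ▸ mem_insert_of_mem _ hi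
    obtain ⟨n, rfl⟩ := this
    exact mem_iUnion.2 ⟨n, hwi⟩

lemma push_le (q : ℂ[X]) (h : ℂ → ℝ≥0∞) (hm : Measurable h) (E : Set ℂ) (hE : volume E = 0)
    (hx : ∀ x ∉ E, ∃ s : Finset ℂ, (∀ w ∈ s, q.eval w = x ∧ q.derivative.eval w ≠ 0) ∧
      h x ≤ ∑ w ∈ s, h w / ‖q.derivative.eval w‖ₑ ^ 2)
    (V : Set ℂ) (hV : MeasurableSet V) :
    ∫⁻ x in V, h x ≤ ∫⁻ x in (fun w => q.eval w) ⁻¹' V, h x := by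
  obtain ⟨A, hAm, hAi, hAd, hAc⟩ := exists_inj_cover q
  have hqc : Continuous (fun w => q.eval w) := q.continuous
  have hemb : ∀ i, MeasurableEmbedding ((A i).domRestrict (fun w => q.eval w)) := fun i =>
    ContinuousOn.measurableEmbedding (hAm i) hqc.continuousOn (hAi i)
  set g : ℂ → ℝ≥0∞ := fun w => h w / ‖q.derivative.eval w‖ₑ ^ 2 with hg
  have hdm : Measurable (fun w => ‖q.derivative.eval w‖ₑ ^ 2) :=
    (q.derivative.continuous.measurable.enorm).pow_const 2
  have hgm : Measurable g := hm.div hdm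
  set G : ℕ → ℂ → ℝ≥0∞ := fun i =>
    Function.extend ((A i).domRestrict (fun w => q.eval w)) (fun w => g w) (fun _ => 0) with hG
  have hGm : ∀ i, Measurable (G i) := fun i =>
    (hemb i).measurable_extend (hgm.comp measurable_subtype_coe) measurable_const
  have hGe : ∀ i, ∀ w ∈ A i, G i (q.eval w) = g w := fun i w hw =>
    (hemb i).injective.extend_apply (fun w : A i => g w) (fun _ => 0) ⟨w, hw⟩
  have hG0 : ∀ i, ∀ x ∉ (fun w => q.eval w) '' (A i), G i x = 0 := by
    intro i x hx
    apply Function.extend_apply'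
    rintro ⟨⟨w, hw⟩, rfl⟩
    exact hx ⟨w, hw, rfl⟩
  have step1 : ∀ x ∉ E, h x ≤ ∑' i, G i x := by
    intro x hxE
    obtain ⟨s, hs, hle⟩ := hx x hxE
    refine hle.trans ?_
    have hidx : ∀ w : s, ∃ i, (w : ℂ) ∈ A i := fun w => mem_iUnion.1 (hAc (hs w w.2).2)
    choose idx hidx using hidx
    have hinj : Function.Injective idx := by
      intro w w' hww
      apply Subtype.ext
      apply hAi (idx w) (hidx w) (hww ▸ hidx w')
      simp only [(hs w w.2).1, (hs w' w'.2).1]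
    calc ∑ w ∈ s, h w / ‖q.derivative.eval w‖ₑ ^ 2 = ∑ w : s, g w := by
          rw [Finset.sum_coe_sort s g]
      _ = ∑' w : s, g w := (tsum_fintype _).symm
      _ = ∑' w : s, G (idx w) x := by
          congr 1; ext w
          rw [← hGe _ _ (hidx w), (hs w w.2).1]
      _ ≤ ∑' i, G i x := ENNReal.tsum_comp_le_tsum_of_injective hinj (fun i => G i x)
  have step2 : ∀ i, ∫⁻ x in V, G i x ≤ ∫⁻ x in A i ∩ (fun w => q.eval w) ⁻¹' V, h x := by
    intro i
    set B := A i ∩ (fun w => q.eval w) ⁻¹' V with hB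
    have hBm : MeasurableSet B := (hAm i).inter (hqc.measurable hV)
    have himg : MeasurableSet ((fun w => q.eval w) '' B) :=
      hBm.image_of_continuousOn_injOn hqc.continuousOn ((hAi i).mono inter_subset_left)
    have e1 : ∫⁻ x in V, G i x ≤ ∫⁻ x in (fun w => q.eval w) '' B, G i x := by
      rw [← lintegral_indicator hV, ← lintegral_indicator himg]
      apply lintegral_mono
      intro x
      by_cases hxV : x ∈ V
      · by_cases hxi : x ∈ (fun w => q.eval w) '' A i
        · obtain ⟨w, hw, rfl⟩ := hxi
          have : (fun w => q.eval w) w ∈ (fun w => q.eval w) '' B := ⟨w, ⟨hw, hxV⟩, rfl⟩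
          rw [indicator_of_mem hxV, indicator_of_mem this]
        · rw [indicator_of_mem hxV, hG0 i x hxi]; exact zero_le
      · rw [indicator_of_notMem hxV]; exact zero_le
    refine e1.trans ?_
    rw [lintegral_image_eq_lintegral_abs_det_fderiv_mul volume hBm
      (f' := fun w => (ContinuousLinearMap.toSpanSingleton ℂ (q.derivative.eval w)).restrictScalars ℝ)
      (fun w _ => ((q.hasDerivAt w).hasFDerivAt.restrictScalars ℝ).hasFDerivWithinAt)
      ((hAi i).mono inter_subset_left)]
    apply setLIntegral_mono' hBm
    intro w hw
    rw [hGe i w hw.1]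
    have hdet : |((ContinuousLinearMap.toSpanSingleton ℂ (q.derivative.eval w)).restrictScalars
        ℝ).det| = ‖q.derivative.eval w‖ ^ 2 := by
      simp [ContinuousLinearMap.det, LinearMap.det_restrictScalars,
        Algebra.norm_complex_eq, Complex.normSq_eq_norm_sq]
    rw [hdet, ENNReal.ofReal_pow (norm_nonneg _), ofReal_norm]
    simp only [hg]
    exact ENNReal.mul_div_le
  calc ∫⁻ x in V, h x ≤ ∫⁻ x in V, ∑' i, G i x := by
        apply lintegral_mono_ae
        apply ae_restrict_of_ae
        have : ∀ᵐ x ∂(volume : Measure ℂ), x ∉ E := by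
          rw [ae_iff]; simpa using hE
        filter_upwards [this] with x hx using step1 x hx
    _ = ∑' i, ∫⁻ x in V, G i x := lintegral_tsum (fun i => (hGm i).aemeasurable)
    _ ≤ ∑' i, ∫⁻ x in A i ∩ (fun w => q.eval w) ⁻¹' V, h x := ENNReal.tsum_le_tsum step2
    _ = ∫⁻ x in ⋃ i, (A i ∩ (fun w => q.eval w) ⁻¹' V), h x := by
        rw [lintegral_iUnion]
        · intro i; exact (hAm i).inter (hqc.measurable hV)
        · intro i j hij
          exact (hAd hij).mono inter_subset_left inter_subset_left
    _ ≤ _ := by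
        apply lintegral_mono_set
        exact iUnion_subset fun i => inter_subset_right

lemma annulus_small (f : ℂ → ℂ) (h : ℂ → ℝ≥0∞) (b : ℂ) (k : ℕ) (hk : 2 ≤ k) (C δ : ℝ)
    (hC : 0 < C) (hδ : 0 < δ)
    (hh : ∀ z, z ≠ b → ‖z - b‖ < δ → h z ≤ ENNReal.ofReal (C / ‖z - b‖ ^ k))
    (hf : ∀ z, ‖z - b‖ < δ → ‖f z - b‖ ≤ ‖z - b‖ + C * ‖z - b‖ ^ k) :
    Filter.Tendsto (fun ε : ℝ => ∫⁻ z in {z | ‖z - b‖ ≤ ε ∧ ε < ‖f z - b‖}, h z)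
      (𝓝[>] 0) (𝓝 0) := by
  have hlim : Filter.Tendsto (fun ε : ℝ => ENNReal.ofReal ((C * 2 ^ k * (2 * C * Real.pi)) * ε))
      (𝓝[>] 0) (𝓝 0) := by
    have : Filter.Tendsto (fun ε : ℝ => (C * 2 ^ k * (2 * C * Real.pi)) * ε) (𝓝[>] 0) (𝓝 0) := by
      have h1 : Continuous (fun ε : ℝ => (C * 2 ^ k * (2 * C * Real.pi)) * ε) := by fun_prop
      have := h1.tendsto 0
      simp only [mul_zero] at this
      exact this.mono_left nhdsWithin_le_nhds
    simpa using ENNReal.tendsto_ofReal this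
  refine tendsto_of_tendsto_of_tendsto_of_le_of_le' tendsto_const_nhds hlim
    (Filter.Eventually.of_forall fun _ => zero_le) ?_
  have hsm : ∀ᶠ ε : ℝ in 𝓝[>] 0, C * ε ^ (k - 1) < 1 / 2 := by
    have h1 : Continuous (fun ε : ℝ => C * ε ^ (k - 1)) := by fun_prop
    have := h1.tendsto 0
    rw [zero_pow (by omega), mul_zero] at this
    exact (this.mono_left nhdsWithin_le_nhds).eventually (gt_mem_nhds (by norm_num))
  have hsd : ∀ᶠ ε : ℝ in 𝓝[>] 0, ε < δ := nhdsWithin_le_nhds (gt_mem_nhds hδ)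
  filter_upwards [hsm, hsd, self_mem_nhdsWithin] with ε h1 h2 h3
  have h3 : 0 < ε := h3
  set t := C * ε ^ k with ht
  have ht0 : 0 < t := by positivity
  have ht2 : t < ε / 2 := by
    have : ε ^ k = ε ^ (k - 1) * ε := by rw [← pow_succ]; congr 1; omega
    rw [ht, this]; nlinarith
  have hsub : {z | ‖z - b‖ ≤ ε ∧ ε < ‖f z - b‖} ⊆ Metric.closedBall b ε \ Metric.ball b (ε - t) := by
    rintro z ⟨hz1, hz2⟩
    refine ⟨by simpa [dist_eq_norm] using hz1, ?_⟩
    simp only [Metric.mem_ball, dist_eq_norm, not_lt]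
    have := hf z (by linarith)
    have h5 : C * ‖z - b‖ ^ k ≤ t := by rw [ht]; gcongr
    linarith
  set B := Metric.closedBall b ε \ Metric.ball b (ε - t) with hB
  have hBm : MeasurableSet B := measurableSet_closedBall.diff measurableSet_ball
  have hvol : volume B ≤ ENNReal.ofReal (2 * C * Real.pi * ε ^ (k + 1)) := by
    rw [hB, measure_sdiff (Metric.ball_subset_closedBall.trans
      (Metric.closedBall_subset_closedBall (by linarith)))
      measurableSet_ball.nullMeasurableSet (by
        rw [Complex.volume_ball]; exact ENNReal.mul_ne_top (by simp) (by simp)),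
      Complex.volume_ball, Complex.volume_closedBall]
    have hpi : (NNReal.pi : ℝ≥0∞) = ENNReal.ofReal Real.pi := by
      rw [← NNReal.coe_real_pi, ENNReal.ofReal_coe_nnreal]
    rw [hpi, ← ENNReal.ofReal_pow h3.le, ← ENNReal.ofReal_pow (by linarith),
      ← ENNReal.ofReal_mul (by positivity), ← ENNReal.ofReal_mul (by positivity),
      ← ENNReal.ofReal_sub _ (by positivity)]
    apply ENNReal.ofReal_le_ofReal
    have : 2 * C * Real.pi * ε ^ (k + 1) = 2 * t * ε * Real.pi := by rw [ht]; ring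
    rw [this]
    nlinarith [Real.pi_pos, mul_pos ht0 ht0, mul_pos (mul_pos ht0 ht0) Real.pi_pos]
  calc ∫⁻ z in {z | ‖z - b‖ ≤ ε ∧ ε < ‖f z - b‖}, h z ≤ ∫⁻ z in B, h z := lintegral_mono_set hsub
    _ ≤ ∫⁻ z in B, ENNReal.ofReal (C * 2 ^ k / ε ^ k) := by
        apply setLIntegral_mono' hBm
        rintro z ⟨hz1, hz2⟩
        simp only [Metric.mem_ball, Metric.mem_closedBall, dist_eq_norm, not_lt] at hz1 hz2
        have hz3 : ε / 2 ≤ ‖z - b‖ := by linarith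
        refine (hh z ?_ (by linarith)).trans (ENNReal.ofReal_le_ofReal ?_)
        · rintro rfl; simp at hz3; linarith
        · calc C / ‖z - b‖ ^ k ≤ C / (ε / 2) ^ k := by gcongr
            _ = _ := by rw [div_pow]; field_simp
    _ = ENNReal.ofReal (C * 2 ^ k / ε ^ k) * volume B := by rw [setLIntegral_const]
    _ ≤ ENNReal.ofReal (C * 2 ^ k / ε ^ k) * ENNReal.ofReal (2 * C * Real.pi * ε ^ (k + 1)) := by
        gcongr
    _ = _ := by
        rw [← ENNReal.ofReal_mul (by positivity)]
        congr 1
        field_simp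
        ring

lemma no_invariant (Q : ℂ[X]) (hQ : 2 ≤ Q.natDegree) (h : ℂ → ℝ≥0∞)
    (S : Finset ℂ) (k : ℂ → ℕ) (hk : ∀ b, 2 ≤ k b)
    (hpush : ∀ V : Set ℂ, MeasurableSet V →
      ∫⁻ x in V, h x ≤ ∫⁻ x in (fun w => Q.eval w) ⁻¹' V, h x)
    (hbd : ∀ b ∈ S, ∃ C δ : ℝ, 0 < C ∧ 0 < δ ∧
      (∀ z, z ≠ b → ‖z - b‖ < δ → h z ≤ ENNReal.ofReal (C / ‖z - b‖ ^ k b)) ∧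
      (∀ z, ‖z - b‖ < δ → ‖Q.eval z - b‖ ≤ ‖z - b‖ + C * ‖z - b‖ ^ k b))
    (hfin : ∀ ε R : ℝ, 0 < ε → ∃ B : ℝ, ∀ z, ‖z‖ < R → (∀ b ∈ S, ε < ‖z - b‖) →
      h z ≤ ENNReal.ofReal B)
    (hpos : ∀ A : Set ℂ, MeasurableSet A → ∫⁻ x in A, h x = 0 → volume A = 0) : False := by
  -- escape radius
  obtain ⟨R, hR1, hR2, hR0⟩ : ∃ R : ℝ, (∀ z : ℂ, R ≤ ‖z‖ → R + 1 ≤ ‖Q.eval z‖) ∧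
      (∀ b ∈ S, ‖b‖ + 1 < R) ∧ 0 < R := by
    have hesc : ∃ R₀ : ℝ, ∀ z : ℂ, R₀ ≤ ‖z‖ → ‖z‖ + 1 ≤ ‖Q.eval z‖ := by
      have h1 : Filter.Tendsto (fun z : ℂ => ‖(Q.divX - C 2).eval z‖) (Filter.cocompact ℂ)
          Filter.atTop := by
        apply Polynomial.tendsto_norm_atTop _ _ tendsto_norm_cocompact_atTop
        rw [← Polynomial.natDegree_pos_iff_degree_pos, Polynomial.natDegree_sub_C,
          Polynomial.natDegree_divX_eq_natDegree_tsub_one]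
        omega
      have h2 := h1.eventually_ge_atTop (4 + ‖Q.coeff 0‖)
      rw [← Metric.cobounded_eq_cocompact, ← comap_norm_atTop, Filter.eventually_comap] at h2
      obtain ⟨R₀, hR₀⟩ := Filter.eventually_atTop.1 h2
      refine ⟨max R₀ 1, fun z hz => ?_⟩
      have hz1 : 1 ≤ ‖z‖ := le_trans (le_max_right _ _) hz
      have h3 := hR₀ ‖z‖ (le_trans (le_max_left _ _) hz) z rfl
      have h4 : Q.eval z = z * (Q.divX - C 2).eval z + 2 * z + Q.coeff 0 := by
        conv_lhs => rw [← Polynomial.divX_mul_X_add Q]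
        simp; ring
      have h5 : ‖z * (Q.divX - C 2).eval z‖ ≤ ‖Q.eval z‖ + 2 * ‖z‖ + ‖Q.coeff 0‖ := by
        have : z * (Q.divX - C 2).eval z = Q.eval z - 2 * z - Q.coeff 0 := by rw [h4]; ring
        rw [this]
        refine (norm_sub_le _ _).trans ?_
        have := norm_sub_le (Q.eval z) (2 * z)
        rw [norm_mul] at this
        simp at this
        linarith
      rw [norm_mul] at h5
      nlinarith [norm_nonneg (Q.coeff 0)]
    obtain ⟨R₀, hR₀⟩ := hesc
    obtain ⟨R₁, hR₁⟩ : ∃ R₁ : ℝ, ∀ b ∈ S, ‖b‖ ≤ R₁ := by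
      obtain ⟨M, hM⟩ := (S.image (fun b => ‖b‖)).exists_le
      exact ⟨M, fun b hb => hM _ (Finset.mem_image_of_mem _ hb)⟩
    refine ⟨max (max R₀ (R₁ + 2)) 1, fun z hz => ?_, fun b hb => ?_, by positivity⟩
    · have := hR₀ z (le_trans (le_trans (le_max_left _ _) (le_max_left _ _)) hz)
      linarith
    · have := hR₁ b hb
      have h3 : R₁ + 2 ≤ max (max R₀ (R₁ + 2)) 1 :=
        le_trans (le_max_right _ _) (le_max_left _ _)
      linarith
  set Z : ℂ → ℝ → Set ℂ := fun b ε => {z | ‖z - b‖ ≤ ε ∧ ε < ‖Q.eval z - b‖} with hZ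
  have hlim : Filter.Tendsto (fun ε : ℝ => ∑ b ∈ S, ∫⁻ z in Z b ε, h z) (𝓝[>] 0) (𝓝 0) := by
    have : (0 : ℝ≥0∞) = ∑ b ∈ S, 0 := by simp
    rw [this]
    apply tendsto_finsetSum
    intro b hb
    obtain ⟨C, δ, hC, hδ, h1, h2⟩ := hbd b hb
    exact annulus_small _ h b (k b) (hk b) C δ hC hδ h1 h2
  set An : Set ℂ := Metric.ball 0 (R + 1) \ Metric.ball 0 R with hAn
  have hAnm : MeasurableSet An := measurableSet_ball.diff measurableSet_ball
  have hle : ∀ᶠ ε : ℝ in 𝓝[>] 0, ∫⁻ z in An, h z ≤ ∑ b ∈ S, ∫⁻ z in Z b ε, h z := by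
    have hs1 : ∀ᶠ ε : ℝ in 𝓝[>] 0, ε < 1 := nhdsWithin_le_nhds (gt_mem_nhds one_pos)
    filter_upwards [hs1, self_mem_nhdsWithin] with ε h1 h3
    have h3 : 0 < ε := h3
    set V : Set ℂ := Metric.ball 0 (R + 1) \ ⋃ b ∈ S, Metric.closedBall b ε with hVdef
    have hVm : MeasurableSet V := measurableSet_ball.diff
      (S.measurableSet_biUnion fun b _ => measurableSet_closedBall)
    have hVZ : ∀ z, z ∈ V ↔ ‖z‖ < R + 1 ∧ ∀ b ∈ S, ε < ‖z - b‖ := by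
      intro z; simp [hVdef, dist_eq_norm]
    have hsub : (fun w => Q.eval w) ⁻¹' V ⊆ (V ∩ Metric.ball 0 R) ∪ ⋃ b ∈ S, Z b ε := by
      intro z hz
      have hz' := (hVZ _).1 hz
      have hzR : ‖z‖ < R := by
        by_contra hcon
        have := hR1 z (not_lt.1 hcon)
        simp only at hz'
        linarith [hz'.1]
      by_cases hzV : z ∈ V
      · exact Or.inl ⟨hzV, by simpa using hzR⟩
      · right
        rw [hVZ] at hzV
        push Not at hzV
        obtain ⟨b, hb, hzb⟩ := hzV (by linarith)
        simp only [mem_iUnion]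
        exact ⟨b, hb, hzb, hz'.2 b hb⟩
    have hAV : V \ Metric.ball 0 R = An := by
      ext z
      rw [mem_sdiff, hVZ, hAn, mem_sdiff]
      simp only [Metric.mem_ball, dist_zero_right, not_lt]
      constructor
      · rintro ⟨⟨h1, -⟩, h2⟩; exact ⟨h1, h2⟩
      · rintro ⟨h4, h5⟩
        refine ⟨⟨h4, fun b hb => ?_⟩, h5⟩
        have := hR2 b hb
        have h6 : ‖z‖ ≤ ‖z - b‖ + ‖b‖ := by simpa using norm_add_le (z - b) b
        linarith
    have hmain := hpush V hVm
    have hsplit : ∫⁻ x in V, h x = (∫⁻ x in V ∩ Metric.ball 0 R, h x) + ∫⁻ x in An, h x := by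
      rw [← hAV, lintegral_inter_add_sdiff _ _ measurableSet_ball]
    have hun : ∫⁻ x in (fun w => Q.eval w) ⁻¹' V, h x ≤
        (∫⁻ x in V ∩ Metric.ball 0 R, h x) + ∑ b ∈ S, ∫⁻ x in Z b ε, h x := by
      refine (lintegral_mono_set hsub).trans ((lintegral_union_le _ _ _).trans ?_)
      gcongr
      have : ∀ T : Finset ℂ, ∫⁻ x in ⋃ b ∈ T, Z b ε, h x ≤ ∑ b ∈ T, ∫⁻ x in Z b ε, h x := by
        intro T
        classical
        induction T using Finset.induction_on with
        | empty => simp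
        | insert a T ha ih =>
          rw [Finset.set_biUnion_insert, Finset.sum_insert ha]
          exact (lintegral_union_le _ _ _).trans (by gcongr)
      exact this S
    have hne : ∫⁻ x in V ∩ Metric.ball 0 R, h x ≠ ∞ := by
      obtain ⟨B, hB⟩ := hfin ε (R + 1) h3
      have : ∫⁻ x in V ∩ Metric.ball 0 R, h x ≤
          ∫⁻ x in V ∩ Metric.ball 0 R, ENNReal.ofReal B := by
        apply setLIntegral_mono' (hVm.inter measurableSet_ball)
        intro z hz
        have := (hVZ z).1 hz.1
        exact hB z this.1 this.2
      refine ne_top_of_le_ne_top ?_ this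
      rw [setLIntegral_const]
      refine ENNReal.mul_ne_top (by simp) ?_
      exact ne_top_of_le_ne_top (measure_ball_lt_top (x := (0 : ℂ)) (r := R)).ne
        (measure_mono inter_subset_right)
    rw [hsplit] at hmain
    exact (ENNReal.add_le_add_iff_left hne).1 (hmain.trans hun)
  have h0 : ∫⁻ z in An, h z = 0 := le_antisymm (ge_of_tendsto hlim hle) zero_le
  have h1 := hpos An hAnm h0
  -- the annulus has positive measure
  have h2 : Metric.ball ((R + 1 / 2 : ℝ) : ℂ) (1 / 2) ⊆ An := by
    intro z hz
    rw [Metric.mem_ball, dist_eq_norm] at hz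
    have hn : ‖((R + 1 / 2 : ℝ) : ℂ)‖ = R + 1 / 2 := by
      rw [Complex.norm_real, Real.norm_of_nonneg (by linarith)]
    have h3 := norm_sub_norm_le z ((R + 1 / 2 : ℝ) : ℂ)
    have h4 := norm_sub_norm_le ((R + 1 / 2 : ℝ) : ℂ) z
    rw [norm_sub_rev] at h4
    rw [hn] at h3 h4
    simp only [hAn, mem_sdiff, Metric.mem_ball, dist_zero_right, not_lt]
    constructor <;> linarith
  have h3 := measure_mono_null h2 h1
  exact (Metric.measure_ball_pos volume _ (by norm_num : (0 : ℝ) < 1 / 2)).ne' h3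

lemma coeff_divX_iter (M : ℂ[X]) (k j : ℕ) : (divX^[k] M).coeff j = M.coeff (j + k) := by
  induction k generalizing j with
  | zero => simp
  | succ k ih => rw [Function.iterate_succ_apply', coeff_divX, ih]; congr 1; omega

lemma lagrange_one (q : ℂ[X]) (hq : 2 ≤ q.natDegree) (x : ℂ)
    (hx : ∀ w, q.eval w = x → q.derivative.eval w ≠ 0) :
    ∃ s : Finset ℂ, (∀ w, w ∈ s ↔ q.eval w = x) ∧
      ∀ L : ℂ → ℂ[X], (∀ w ∈ s, q - C x = (X - C w) * L w) →
        ∑ w ∈ s, C ((q.derivative.eval w)⁻¹) * L w = 1 := by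
  classical
  have hdeg : (q - C x).natDegree = q.natDegree := natDegree_sub_C
  have hne : q - C x ≠ 0 := by
    intro h; rw [h] at hdeg; simp at hdeg; omega
  have hmem : ∀ w, w ∈ (q - C x).roots.toFinset ↔ q.eval w = x := by
    intro w; simp [hne, sub_eq_zero]
  have hnd : (q - C x).roots.Nodup := by
    rw [Multiset.nodup_iff_count_le_one]
    intro w
    rw [count_roots]
    by_contra hcon
    rw [not_le, one_lt_rootMultiplicity_iff_isRoot hne] at hcon
    have h1 : q.eval w = x := by simpa [sub_eq_zero] using hcon.1
    apply hx w h1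
    simpa using hcon.2
  have hcard : (q - C x).roots.toFinset.card = q.natDegree := by
    rw [Multiset.toFinset_card_of_nodup hnd, ← hdeg]
    exact (IsAlgClosed.splits (q - C x)).natDegree_eq_card_roots.symm
  refine ⟨(q - C x).roots.toFinset, hmem, fun L hL => ?_⟩
  set s := (q - C x).roots.toFinset with hs
  have hLdeg : ∀ w ∈ s, (L w).natDegree < q.natDegree := by
    intro w hw
    have h1 := hL w hw
    have h2 : L w ≠ 0 := by rintro h; rw [h, mul_zero] at h1; exact hne h1
    have h3 := congrArg natDegree h1
    rw [hdeg, natDegree_mul (X_sub_C_ne_zero w) h2, natDegree_X_sub_C] at h3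
    omega
  rw [← sub_eq_zero]
  apply eq_zero_of_natDegree_lt_card_of_eval_eq_zero' _ s
  · intro w hw
    rw [eval_sub, eval_finsetSum, Finset.sum_eq_single w]
    · have h1 := congrArg (fun p => p.derivative.eval w) (hL w hw)
      simp at h1
      simp only [eval_mul, eval_C, eval_one]
      rw [← h1, inv_mul_cancel₀ (hx w ((hmem w).1 hw)), sub_self]
    · intro v hv hvw
      have h1 := congrArg (fun p => p.eval w) (hL v hv)
      simp [(hmem w).1 hw, sub_eq_zero, hvw.symm] at h1
      simp [h1]
    · intro h; exact absurd hw h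
  · rw [hcard]
    refine lt_of_le_of_lt (natDegree_sub_le _ _) ?_
    rw [natDegree_one, max_lt_iff]
    refine ⟨?_, by omega⟩
    have : (∑ w ∈ s, C ((q.derivative.eval w)⁻¹) * L w).natDegree ≤ q.natDegree - 1 := by
      apply natDegree_sum_le_of_forall_le
      intro w hw
      refine (natDegree_C_mul_le _ _).trans ?_
      have := hLdeg w hw
      omega
    omega

lemma transfer (q M : ℂ[X]) (hq : 2 ≤ q.natDegree) (hM : M.Monic) (hdvd : M ∣ M.comp q)
    (μ : ℂ[X] →ₗ[ℂ] ℂ) (h1 : ∀ φ, μ (M * φ) = 0) (ζ : ℂ)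
    (h2 : ∀ φ : ℂ[X], μ (φ.comp q) = ζ * μ (q.derivative * φ))
    (h3 : ∀ φ : ℂ[X], φ.natDegree ≤ q.natDegree - 2 → μ φ = 0) (hμ : μ ≠ 0) :
    ∃ N : ℂ[X], N ≠ 0 ∧ ∀ x, M.eval x ≠ 0 → (∀ w, q.eval w = x → q.derivative.eval w ≠ 0) →
      ∃ s : Finset ℂ, (∀ w ∈ s, q.eval w = x ∧ q.derivative.eval w ≠ 0) ∧
        ∑ w ∈ s, (q.derivative.eval w * N.eval w / M.eval w) / (q.derivative.eval w) ^ 2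
          = ζ * (q.derivative.eval x * N.eval x / M.eval x) := by
  have hsm : ∀ (c : ℂ) (φ : ℂ[X]), μ (C c * φ) = c * μ φ := by
    intro c φ; rw [← smul_eq_C_mul, map_smul, smul_eq_mul]
  set D : ℂ → ℂ[X] := fun w =>
    ∑ j ∈ Finset.range (M.natDegree + 1), C (w ^ j) * divX^[j + 1] M with hD
  have hDw : ∀ w, (X - C w) * D w = M - C (M.eval w) := by
    intro w
    have tel : ∀ n, (X - C w) * ∑ j ∈ Finset.range n, C (w ^ j) * divX^[j + 1] M =
        M - C (w ^ n) * divX^[n] M - C (∑ j ∈ Finset.range n, M.coeff j * w ^ j) := by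
      intro n
      induction n with
      | zero => simp
      | succ n ih =>
        rw [Finset.sum_range_succ, mul_add, ih, Finset.sum_range_succ]
        have h5 : divX^[n] M = divX^[n + 1] M * X + C (M.coeff n) := by
          have := divX_mul_X_add (divX^[n] M)
          rw [coeff_divX_iter, zero_add] at this
          rw [Function.iterate_succ_apply', this]
        rw [h5]
        simp only [map_add, map_mul, pow_succ]
        ring
    rw [hD]
    simp only
    rw [tel]
    have h0 : divX^[M.natDegree + 1] M = 0 := by
      ext j
      rw [coeff_divX_iter, coeff_zero]
      exact coeff_eq_zero_of_natDegree_lt (by omega)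
    rw [h0, mul_zero, sub_zero, eval_eq_sum_range]
  set N : ℂ[X] := ∑ j ∈ Finset.range (M.natDegree + 1), C (μ (divX^[j + 1] M)) * X ^ j with hN
  have hNw : ∀ w, N.eval w = μ (D w) := by
    intro w
    rw [hN, hD, eval_finsetSum, map_sum]
    refine Finset.sum_congr rfl fun j _ => ?_
    rw [hsm, eval_mul, eval_C, eval_pow, eval_X, mul_comm]
  refine ⟨N, ?_, ?_⟩
  · intro hN0
    have hz : ∀ j, 0 < j → μ (divX^[j] M) = 0 := by
      intro j hj
      obtain ⟨j, rfl⟩ : ∃ i, j = i + 1 := ⟨j - 1, by omega⟩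
      by_cases hjn : j ∈ Finset.range (M.natDegree + 1)
      · have h4 := congrArg (fun p => p.coeff j) hN0
        simp only [hN, finsetSum_coeff, coeff_C_mul, coeff_X_pow, coeff_zero] at h4
        rw [Finset.sum_eq_single j] at h4
        · simpa using h4
        · intro i _ hij; simp [hij.symm]
        · intro h; exact absurd hjn h
      · rw [Finset.mem_range, not_lt] at hjn
        have h0 : divX^[j + 1] M = 0 := by
          ext i
          rw [coeff_divX_iter, coeff_zero]
          exact coeff_eq_zero_of_natDegree_lt (by omega)
        rw [h0, map_zero]
    have hlow : ∀ i ≤ M.natDegree, ∀ φ : ℂ[X], φ.degree < i → μ φ = 0 := by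
      intro i
      induction i with
      | zero => 
        intro _ φ hφ
        have : φ = 0 := by
          rw [← degree_eq_bot]
          simpa using hφ
        rw [this, map_zero]
      | succ i ih =>
        intro hi φ hφ
        have h6 : μ (φ - C (φ.coeff i) * divX^[M.natDegree - i] M) = 0 := by
          apply ih (by omega)
          rw [degree_lt_iff_coeff_zero]
          intro m hm
          rw [coeff_sub, coeff_C_mul, coeff_divX_iter]
          rcases Nat.eq_or_lt_of_le hm with h | h
          · subst h
            rw [show i + (M.natDegree - i) = M.natDegree by omega, hM.coeff_natDegree]
            ring
          · rw [coeff_eq_zero_of_natDegree_lt (p := M) (by omega)]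
            rw [degree_lt_iff_coeff_zero] at hφ
            rw [hφ m (by omega)]; ring
        rw [map_sub, hsm, hz _ (by omega)] at h6
        simpa using h6
    apply hμ
    ext1 n
    ext
    simp only [LinearMap.comp_apply, LinearMap.zero_apply]
    set φ := (monomial n) (1 : ℂ)
    have h7 := modByMonic_add_div φ M
    rw [← h7, map_add, h1, add_zero]
    apply hlow _ le_rfl
    rw [← degree_eq_natDegree hM.ne_zero]
    exact degree_modByMonic_lt _ hM
  · intro x hMx hx
    obtain ⟨s, hs, hlag⟩ := lagrange_one q hq x hx
    refine ⟨s, fun w hw => ⟨(hs w).1 hw, hx w ((hs w).1 hw)⟩, ?_⟩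
    have hL : ∀ w, ∃ L : ℂ[X], w ∈ s → q - C x = (X - C w) * L := by
      intro w
      by_cases hw : w ∈ s
      · have : (X - C w) ∣ q - C x := by
          rw [dvd_iff_isRoot]; simp [(hs w).1 hw]
        obtain ⟨L, hL⟩ := this
        exact ⟨L, fun _ => hL⟩
      · exact ⟨0, fun h => absurd h hw⟩
    choose L hL using hL
    have hsum := hlag L hL
    have hMw : ∀ w ∈ s, M.eval w ≠ 0 := by
      intro w hw h0
      obtain ⟨P, hP⟩ := hdvd
      have := congrArg (fun p => p.eval w) hP
      simp [eval_comp, (hs w).1 hw, h0] at this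
      exact hMx this
    set J : ℂ[X] := ∑ w ∈ s, C ((M.eval w)⁻¹ * (q.derivative.eval w)⁻¹) * D w with hJ
    have hμJ : ∑ w ∈ s, (q.derivative.eval w * N.eval w / M.eval w) / (q.derivative.eval w) ^ 2
        = μ J := by
      rw [hJ, map_sum]
      refine Finset.sum_congr rfl fun w hw => ?_
      rw [hsm, ← hNw]
      have := hx w ((hs w).1 hw)
      have := hMw w hw
      field_simp
    -- J is an inverse of x - q
    have hJ1 : M ∣ (C x - q) * J - 1 := by
      have e1 : (C x - q) * J = 1 - M * ∑ w ∈ s, C ((M.eval w)⁻¹ * (q.derivative.eval w)⁻¹) * L w := by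
        rw [← hsum, hJ, Finset.mul_sum, Finset.mul_sum, ← Finset.sum_sub_distrib]
        refine Finset.sum_congr rfl fun w hw => ?_
        have e2 : C x - q = -((X - C w) * L w) := by rw [← hL w hw]; ring
        have e3 : C (M.eval w) * C ((M.eval w)⁻¹) = (1 : ℂ[X]) := by
          rw [← C_mul, mul_inv_cancel₀ (hMw w hw), C_1]
        have e4 := hDw w
        rw [e2, C_mul]
        linear_combination (-L w * C ((M.eval w)⁻¹) * C ((q.derivative.eval w)⁻¹)) * e4 +
          (L w * C ((q.derivative.eval w)⁻¹)) * e3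
      rw [e1]
      exact ⟨-∑ w ∈ s, C ((M.eval w)⁻¹ * (q.derivative.eval w)⁻¹) * L w, by ring⟩
    set K : ℂ[X] := C ((M.eval x)⁻¹) * (D x).comp q with hK
    have hK1 : M ∣ (C x - q) * K - 1 := by
      obtain ⟨P, hP⟩ := hdvd
      have e1 := congrArg (fun p => p.comp q) (hDw x)
      simp only [mul_comp, sub_comp, X_comp, C_comp] at e1
      have e3 : C (M.eval x) * C ((M.eval x)⁻¹) = (1 : ℂ[X]) := by
        rw [← C_mul, mul_inv_cancel₀ hMx, C_1]
      refine ⟨-C ((M.eval x)⁻¹) * P, ?_⟩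
      rw [hK]
      rw [hP] at e1
      linear_combination (-C ((M.eval x)⁻¹)) * e1 + e3
    have hJK : M ∣ J - K := by
      obtain ⟨a, ha⟩ := hJ1
      obtain ⟨b, hb⟩ := hK1
      exact ⟨a * K - b * J, by linear_combination K * ha - J * hb⟩
    obtain ⟨a, ha⟩ := hJK
    have hμJK : μ J = μ K := by
      rw [← sub_eq_zero, ← map_sub, ha, h1]
    obtain ⟨E, hE⟩ : (X - C x) ∣ q.derivative - C (q.derivative.eval x) := by
      rw [dvd_iff_isRoot]; simp
    have hEdeg : E.natDegree ≤ q.natDegree - 2 := by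
      by_cases hE0 : E = 0
      · simp [hE0]
      · have e1 := congrArg natDegree hE
        rw [natDegree_sub_C, natDegree_mul (X_sub_C_ne_zero x) hE0, natDegree_X_sub_C,
          natDegree_derivative] at e1
        omega
    have hq' : q.derivative * D x = C (q.derivative.eval x) * D x + M * E - C (M.eval x) * E := by
      linear_combination D x * hE + E * hDw x
    rw [hμJ, hμJK, hK, hsm, h2, hq', map_sub, map_add, h1, hsm, hsm, h3 E hEdeg, ← hNw]
    field_simp
    ring

lemma finrank_ker_mul_le {V : Type*} [AddCommGroup V] [Module ℂ V] [FiniteDimensional ℂ V]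
    (f g : Module.End ℂ V) : Module.finrank ℂ (LinearMap.ker (f * g)) ≤
      Module.finrank ℂ (LinearMap.ker f) + Module.finrank ℂ (LinearMap.ker g) := by
  set g' := g.domRestrict (LinearMap.ker (f * g)) with hg'
  have h1 := LinearMap.finrank_range_add_finrank_ker g'
  have h2 : LinearMap.range g' ≤ LinearMap.ker f := by
    rintro _ ⟨⟨v, hv⟩, rfl⟩
    exact hv
  have h3 := Submodule.finrank_mono h2
  have h4 : (LinearMap.ker g').map (LinearMap.ker (f * g)).subtype ≤ LinearMap.ker g := by
    rintro _ ⟨⟨v, hv⟩, hv', rfl⟩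
    simpa [hg'] using hv'
  have h5 := Submodule.finrank_mono h4
  rw [Submodule.finrank_map_subtype_eq] at h5
  omega

lemma finrank_ker_prod_le {V : Type*} [AddCommGroup V] [Module ℂ V] [FiniteDimensional ℂ V]
    (U : Module.End ℂ V) (s : Finset ℂ) :
    Module.finrank ℂ (LinearMap.ker (aeval U (∏ ζ ∈ s, (X - C ζ)))) ≤
      ∑ ζ ∈ s, Module.finrank ℂ (LinearMap.ker (U - algebraMap ℂ _ ζ)) := by
  classical
  induction s using Finset.induction_on with
  | empty =>
    rw [Finset.prod_empty, Finset.sum_empty, map_one, Module.End.one_eq_id, LinearMap.ker_id]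
    simp
  | insert a s ha ih =>
    rw [Finset.prod_insert ha, Finset.sum_insert ha, map_mul]
    refine (finrank_ker_mul_le _ _).trans ?_
    have : aeval U (X - C a) = U - algebraMap ℂ _ a := by simp
    rw [this]
    omega

lemma exists_functional (q M r : ℂ[X]) (m : ℕ) (hm : 0 < m) (hq : 2 ≤ q.natDegree)
    (hM : M.Monic) (hr : r.Monic) (hdvd : M ∣ M.comp q) (hcop : IsCoprime q.derivative M)
    (hcopQ : IsCoprime (q.comp^[m] X).derivative M)
    (hker : ∀ h : ℂ[X], M ∣ (r * h).comp (q.comp^[m] X) - (q.comp^[m] X).derivative * (r * h))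
    (hcount : (q.natDegree - 1) * m < M.natDegree - r.natDegree) :
    ∃ ζ : ℂ, ‖ζ‖ = 1 ∧ ∃ μ : ℂ[X] →ₗ[ℂ] ℂ, μ ≠ 0 ∧ (∀ φ, μ (M * φ) = 0) ∧
      (∀ φ : ℂ[X], μ (φ.comp q) = ζ * μ (q.derivative * φ)) ∧
      (∀ φ : ℂ[X], φ.natDegree ≤ q.natDegree - 2 → μ φ = 0) := by
  have : Module.Finite ℂ (AdjoinRoot M) := hM.finite_adjoinRoot
  have hdim : Module.finrank ℂ (AdjoinRoot M) = M.natDegree := by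
    rw [(AdjoinRoot.powerBasis' hM).finrank, AdjoinRoot.powerBasis'_dim]
  have hcompmk : ∀ φ : ℂ[X], eval₂ (Algebra.ofId ℂ (AdjoinRoot M) : ℂ →+* AdjoinRoot M)
      (AdjoinRoot.mk M q) φ = AdjoinRoot.mk M (φ.comp q) := by
    intro φ
    rw [← AdjoinRoot.aeval_eq (φ.comp q), aeval_comp, AdjoinRoot.aeval_eq]
    rfl
  set Cq : AdjoinRoot M →ₐ[ℂ] AdjoinRoot M :=
    AdjoinRoot.liftAlgHom M (Algebra.ofId ℂ (AdjoinRoot M)) (AdjoinRoot.mk M q) (by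
      rw [hcompmk]; exact AdjoinRoot.mk_eq_zero.2 hdvd) with hCq
  have hCmk : ∀ φ : ℂ[X], Cq (AdjoinRoot.mk M φ) = AdjoinRoot.mk M (φ.comp q) := by
    intro φ
    rw [hCq, AdjoinRoot.liftAlgHom_mk, hcompmk]
  obtain ⟨u, hu⟩ : ∃ u : AdjoinRoot M, u * AdjoinRoot.mk M q.derivative = 1 := by
    obtain ⟨a, b, hab⟩ := hcop
    refine ⟨AdjoinRoot.mk M a, ?_⟩
    rw [← map_mul, ← map_one (AdjoinRoot.mk M), ← sub_eq_zero, ← map_sub, AdjoinRoot.mk_eq_zero]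
    exact ⟨-b, by linear_combination hab⟩
  obtain ⟨v, hv⟩ : ∃ u : AdjoinRoot M, u * AdjoinRoot.mk M (q.comp^[m] X).derivative = 1 := by
    obtain ⟨a, b, hab⟩ := hcopQ
    refine ⟨AdjoinRoot.mk M a, ?_⟩
    rw [← map_mul, ← map_one (AdjoinRoot.mk M), ← sub_eq_zero, ← map_sub, AdjoinRoot.mk_eq_zero]
    exact ⟨-b, by linear_combination hab⟩
  set U : Module.End ℂ (AdjoinRoot M) :=
    (LinearMap.mulLeft ℂ u).comp Cq.toLinearMap with hU
  have hUa : ∀ x, U x = u * Cq x := fun x => rfl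
  -- iterate formula
  have hcc : ∀ j, (q.comp^[j] X).comp q = q.comp^[j + 1] X := by
    intro j
    induction j with
    | zero => simp
    | succ j ih => rw [Function.iterate_succ_apply', comp_assoc, ih, ← Function.iterate_succ_apply' q.comp]
  have hUj : ∀ j (φ : ℂ[X]), (U ^ j) (AdjoinRoot.mk M φ) *
      AdjoinRoot.mk M (q.comp^[j] X).derivative = AdjoinRoot.mk M (φ.comp (q.comp^[j] X)) := by
    intro j φ
    induction j with
    | zero => simp
    | succ j ih =>
      rw [pow_succ', Module.End.mul_apply, hUa, ← hcc, derivative_comp, map_mul, ← hCmk]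
      have e1 := congrArg Cq ih
      rw [map_mul, hCmk (φ.comp _), comp_assoc] at e1
      rw [← e1]
      linear_combination (Cq ((U ^ j) (AdjoinRoot.mk M φ)) *
        Cq (AdjoinRoot.mk M (q.comp^[j] X).derivative)) * hu
  have hfix : ∀ h : ℂ[X], (U ^ m) (AdjoinRoot.mk M (r * h)) = AdjoinRoot.mk M (r * h) := by
    intro h
    have e1 := hUj m (r * h)
    have e2 := AdjoinRoot.mk_eq_zero.2 (hker h)
    rw [map_sub, sub_eq_zero, map_mul (AdjoinRoot.mk M) (derivative _)] at e2
    rw [e2] at e1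
    linear_combination v * e1 +
      (AdjoinRoot.mk M (r * h) - (U ^ m) (AdjoinRoot.mk M (r * h))) * hv
  set W := LinearMap.ker (U ^ m - 1) with hW
  have hWdim : M.natDegree - r.natDegree ≤ Module.finrank ℂ W := by
    set n := M.natDegree - r.natDegree
    set T : degreeLT ℂ n →ₗ[ℂ] AdjoinRoot M :=
      (AdjoinRoot.mkₐ M).toLinearMap ∘ₗ (LinearMap.mulLeft ℂ r) ∘ₗ (degreeLT ℂ n).subtype with hT
    have hTa : ∀ φ, T φ = AdjoinRoot.mk M (r * φ) := fun φ => rfl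
    have hTW : ∀ φ, T φ ∈ W := by
      intro φ
      rw [hW, LinearMap.mem_ker, LinearMap.sub_apply, hTa, hfix]
      simp
    have hinj : Function.Injective (T.codRestrict W hTW) := by
      rw [← LinearMap.ker_eq_bot, LinearMap.ker_codRestrict, LinearMap.ker_eq_bot']
      rintro ⟨φ, hφ⟩ h0
      rw [hTa, AdjoinRoot.mk_eq_zero] at h0
      rw [mem_degreeLT] at hφ
      by_contra hne
      have hφ0 : φ ≠ 0 := fun h => hne (by ext1; exact h)
      have h5 := natDegree_le_of_dvd h0 (mul_ne_zero hr.ne_zero hφ0)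
      rw [natDegree_mul hr.ne_zero hφ0] at h5
      rw [degree_eq_natDegree hφ0] at hφ
      have : φ.natDegree < n := by exact_mod_cast hφ
      omega
    have h6 := LinearMap.finrank_le_finrank_of_injective hinj
    rwa [(degreeLTEquiv ℂ n).finrank_eq, Module.finrank_fin_fun] at h6
  obtain ⟨ζ, hζm, hζ⟩ : ∃ ζ ∈ nthRootsFinset m (1 : ℂ), q.natDegree - 1 <
      Module.finrank ℂ (LinearMap.ker (U - algebraMap ℂ _ ζ)) := by
    have hprim := Complex.isPrimitiveRoot_exp m hm.ne'
    apply Finset.exists_lt_of_sum_lt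
    rw [Finset.sum_const, hprim.card_nthRootsFinset, smul_eq_mul]
    have e1 := finrank_ker_prod_le U (nthRootsFinset m (1 : ℂ))
    rw [← X_pow_sub_one_eq_prod hm hprim] at e1
    rw [map_sub, map_pow, aeval_X, map_one] at e1
    rw [mul_comm]
    exact hcount.trans_le (hWdim.trans e1)
  have hζ1 : ζ ^ m = 1 := (mem_nthRootsFinset hm 1).1 hζm
  have hζn : ‖ζ‖ = 1 := Complex.norm_eq_one_of_pow_eq_one hζ1 hm.ne'
  set A : Module.End ℂ (AdjoinRoot M) :=
    Cq.toLinearMap - ζ • LinearMap.mulLeft ℂ (AdjoinRoot.mk M q.derivative) with hA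
  have hAa : ∀ x, A x = Cq x - ζ • (AdjoinRoot.mk M q.derivative * x) := fun x => rfl
  have hkerA : LinearMap.ker (U - algebraMap ℂ _ ζ) ≤ LinearMap.ker A := by
    intro x hx
    rw [LinearMap.mem_ker, LinearMap.sub_apply, hUa, Module.algebraMap_end_apply, sub_eq_zero] at hx
    rw [LinearMap.mem_ker, hAa, ← mul_smul_comm, ← hx]
    linear_combination (-Cq x) * hu
  have hkd := Submodule.finrank_mono hkerA
  have hrn := LinearMap.finrank_range_add_finrank_ker A
  set L : Submodule ℂ (AdjoinRoot M) :=
    (degreeLT ℂ (q.natDegree - 1)).map (AdjoinRoot.mkₐ M).toLinearMap with hL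
  have : Module.Finite ℂ (degreeLT ℂ (q.natDegree - 1)) :=
    Module.Finite.equiv (degreeLTEquiv ℂ (q.natDegree - 1)).symm
  have hLd : Module.finrank ℂ L ≤ q.natDegree - 1 := by
    refine (Submodule.finrank_map_le _ _).trans ?_
    rw [(degreeLTEquiv ℂ _).finrank_eq, Module.finrank_fin_fun]
  have hsup := Submodule.finrank_add_le_finrank_add_finrank (LinearMap.range A) L
  have hlt : LinearMap.range A ⊔ L < ⊤ := by
    rw [lt_top_iff_ne_top]
    intro htop
    rw [htop, finrank_top] at hsup
    omega
  obtain ⟨f, hf0, hf⟩ := Submodule.exists_le_ker_of_lt_top _ hlt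
  refine ⟨ζ, hζn, f ∘ₗ (AdjoinRoot.mkₐ M).toLinearMap, ?_, ?_, ?_, ?_⟩
  · intro h0
    apply hf0
    ext x
    obtain ⟨φ, rfl⟩ := AdjoinRoot.mk_surjective x
    exact LinearMap.congr_fun h0 φ
  · intro φ
    have : AdjoinRoot.mk M (M * φ) = 0 := AdjoinRoot.mk_eq_zero.2 (dvd_mul_right _ _)
    change f (AdjoinRoot.mk M (M * φ)) = 0
    rw [this, map_zero]
  · intro φ
    change f (AdjoinRoot.mk M (φ.comp q)) = ζ * f (AdjoinRoot.mk M (q.derivative * φ))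
    have h5 : f (A (AdjoinRoot.mk M φ)) = 0 :=
      hf (Submodule.mem_sup_left (LinearMap.mem_range_self _ _))
    rw [hAa, map_sub, map_smul, hCmk, ← map_mul, sub_eq_zero, smul_eq_mul] at h5
    exact h5
  · intro φ hφ
    apply hf
    apply Submodule.mem_sup_right
    refine ⟨φ, ?_, rfl⟩
    change φ ∈ degreeLT ℂ (q.natDegree - 1)
    rw [mem_degreeLT]
    refine lt_of_le_of_lt degree_le_natDegree ?_
    exact_mod_cast (by omega : φ.natDegree < q.natDegree - 1)

lemma comp_iter_comm (q : ℂ[X]) (j : ℕ) : (q.comp^[j] X).comp q = q.comp (q.comp^[j] X) := by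
  induction j with
  | zero => simp
  | succ j ih => rw [Function.iterate_succ_apply', comp_assoc, ih]

lemma dvd_comp_sub (q Q : ℂ[X]) : (Q - X) ∣ q.comp Q - q := by
  have h := sub_dvd_eval_sub Q X (q.map C)
  have e1 : (q.map C).eval Q = q.comp Q := by rw [eval_map]; rfl
  have e2 : (q.map C).eval X = q := by rw [eval_map]; exact comp_X
  rwa [e1, e2] at h

lemma mult_comp_le (P q : ℂ[X]) (b : ℂ) (hP : P ≠ 0) (hb : q.derivative.eval b ≠ 0) :
    (P.comp q).rootMultiplicity b ≤ P.rootMultiplicity (q.eval b) := by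
  obtain ⟨P1, hP1, hnd⟩ := exists_eq_pow_rootMultiplicity_mul_and_not_dvd P hP (q.eval b)
  set j := P.rootMultiplicity (q.eval b)
  obtain ⟨u, hu⟩ : (X - C b) ∣ q - C (q.eval b) := by
    rw [dvd_iff_isRoot]; simp
  have hub : u.eval b = q.derivative.eval b := by
    have := congrArg (fun p => p.derivative.eval b) hu
    simpa using this.symm
  by_contra hcon
  rw [not_le] at hcon
  have h1 : (X - C b) ^ (j + 1) ∣ P.comp q :=
    (pow_dvd_pow _ hcon).trans (pow_rootMultiplicity_dvd _ _)
  have h2 : P.comp q = (X - C b) ^ j * (u ^ j * P1.comp q) := by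
    conv_lhs => rw [hP1]
    simp only [mul_comp, pow_comp, sub_comp, X_comp, C_comp]
    rw [hu, mul_pow]; ring
  rw [h2, pow_succ, mul_dvd_mul_iff_left (pow_ne_zero _ (X_sub_C_ne_zero b)), dvd_iff_isRoot] at h1
  rw [dvd_iff_isRoot] at hnd
  simp [IsRoot, hub, hb, eval_comp] at h1 hnd
  exact hnd h1

lemma wronski_dvd (Q φ : ℂ[X]) (b : ℂ) (hP : Q - X ≠ 0) (hQ : Q.eval b = b)
    (hφ : (X - C b) ∣ φ) :
    (X - C b) ^ (max 2 ((Q - X).rootMultiplicity b)) ∣ φ.comp Q - Q.derivative * φ := by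
  have hpos : 0 < (Q - X).rootMultiplicity b := by
    rw [rootMultiplicity_pos hP]; simp [hQ]
  obtain ⟨g, hg⟩ := pow_rootMultiplicity_dvd (Q - X) b
  obtain ⟨n, hn⟩ : ∃ n, (Q - X).rootMultiplicity b = n + 1 := ⟨_, (Nat.succ_pred_eq_of_pos hpos).symm⟩
  rw [hn] at hg ⊢
  obtain ⟨ψ, hψ⟩ := hφ
  obtain ⟨K, hK⟩ := binomExpansion (φ.map C) X (Q - X)
  have e1 : (φ.map C).eval (X + (Q - X)) = φ.comp Q := by
    rw [add_sub_cancel, eval_map]; rfl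
  have e2 : (φ.map C).eval X = φ := by rw [eval_map]; exact comp_X
  have e3 : (φ.map C).derivative.eval X = φ.derivative := by
    rw [derivative_map, eval_map]; exact comp_X
  rw [e1, e2, e3] at hK
  have hQ' : Q.derivative = 1 + derivative (Q - X) := by simp
  have hφ' : φ.derivative = ψ + (X - C b) * ψ.derivative := by rw [hψ]; simp
  have hP' : derivative (Q - X) = ((n : ℂ[X]) + 1) * (X - C b) ^ n * g + (X - C b) ^ (n + 1) * g.derivative := by
    rw [hg]; simp [derivative_pow]
  have key : φ.comp Q - Q.derivative * φ = (X - C b) ^ (n + 1) *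
      (-(n : ℂ[X]) * g * ψ + (X - C b) * (ψ.derivative * g - g.derivative * ψ)
        + K * (X - C b) ^ (n + 1) * g ^ 2) := by
    rw [hK, hQ', hP', hφ', hg]
    conv_lhs => rw [hψ]
    ring
  rw [key]
  rcases Nat.eq_zero_or_pos n with h0 | h0
  · subst h0
    refine ⟨(ψ.derivative * g - g.derivative * ψ) + K * g ^ 2, ?_⟩
    simp; ring
  · rw [max_eq_right (by omega)]
    exact dvd_mul_right _ _

lemma linear_dvd (Q : ℂ[X]) (b : ℂ) (hP : Q - X ≠ 0) (hQ : Q.eval b = b) :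
    (X - C b) ^ (max 2 ((Q - X).rootMultiplicity b)) ∣
      Q - C b - C (Q.derivative.eval b) * (X - C b) := by
  rcases le_total ((Q - X).rootMultiplicity b) 1 with h | h
  · rw [max_eq_left (by omega)]
    obtain ⟨u, hu⟩ : (X - C b) ∣ Q - C b := by rw [dvd_iff_isRoot]; simp [hQ]
    have hub : u.eval b = Q.derivative.eval b := by
      have := congrArg (fun p => p.derivative.eval b) hu
      simpa using this.symm
    obtain ⟨v, hv⟩ : (X - C b) ∣ u - C (Q.derivative.eval b) := by
      rw [dvd_iff_isRoot]; simp [hub]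
    exact ⟨v, by linear_combination hu + (X - C b) * hv⟩
  · rcases Nat.eq_or_lt_of_le h with h1 | h1
    · rw [max_eq_left (by omega)]
      obtain ⟨u, hu⟩ : (X - C b) ∣ Q - C b := by rw [dvd_iff_isRoot]; simp [hQ]
      have hub : u.eval b = Q.derivative.eval b := by
        have := congrArg (fun p => p.derivative.eval b) hu
        simpa using this.symm
      obtain ⟨v, hv⟩ : (X - C b) ∣ u - C (Q.derivative.eval b) := by
        rw [dvd_iff_isRoot]; simp [hub]
      exact ⟨v, by linear_combination hu + (X - C b) * hv⟩
    · have h2 := (one_lt_rootMultiplicity_iff_isRoot hP).1 h1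
      have h3 : Q.derivative.eval b = 1 := by
        have := h2.2
        simpa [IsRoot, sub_eq_zero] using this
      rw [h3, max_eq_right (by omega), C_1]
      have : Q - C b - 1 * (X - C b) = Q - X := by ring
      rw [this]
      exact pow_rootMultiplicity_dvd _ _

lemma iter_eval (q : ℂ[X]) (m : ℕ) (x : ℂ) :
    (q.comp^[m] X).eval x = (fun w => q.eval w)^[m] x := by
  rw [iterate_comp_eval]; simp

lemma iter_deriv (q : ℂ[X]) (m : ℕ) (x : ℂ) :
    (q.comp^[m] X).derivative.eval x =
      ∏ i ∈ Finset.range m, q.derivative.eval ((fun w => q.eval w)^[i] x) := by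
  induction m with
  | zero => simp
  | succ m ih =>
    rw [Function.iterate_succ_apply', derivative_comp, Finset.prod_range_succ, eval_mul, ih,
      eval_comp, iter_eval]

lemma iter_deriv_step (q : ℂ[X]) (m : ℕ) (x : ℂ) (hx : (fun w => q.eval w)^[m] x = x) :
    (q.comp^[m] X).derivative.eval (q.eval x) = (q.comp^[m] X).derivative.eval x := by
  rcases m with _ | n
  · simp
  · have e : ∀ i, (fun w => q.eval w)^[i] (q.eval x) = (fun w => q.eval w)^[i + 1] x := fun i => by
      rw [Function.iterate_succ_apply]
    rw [iter_deriv, iter_deriv, Finset.prod_range_succ, Finset.prod_range_succ']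
    simp only [e]
    rw [hx]; rfl

lemma iter_natDegree (q : ℂ[X]) (m : ℕ) : (q.comp^[m] X).natDegree = q.natDegree ^ m := by
  rw [natDegree_iterate_comp]; simp

lemma iter_sub_X_ne (q : ℂ[X]) (hq : 2 ≤ q.natDegree) (m : ℕ) (hm : 0 < m) :
    (q.comp^[m] X) - X ≠ 0 ∧ ((q.comp^[m] X) - X).natDegree = q.natDegree ^ m := by
  have h2 : 2 ≤ q.natDegree ^ m := hq.trans (Nat.le_self_pow hm.ne' _)
  have h3 : ((q.comp^[m] X) - X).natDegree = q.natDegree ^ m := by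
    rw [natDegree_sub_eq_left_of_natDegree_lt, iter_natDegree]
    rw [iter_natDegree, natDegree_X]; omega
  refine ⟨fun h => ?_, h3⟩
  rw [h] at h3; simp at h3; omega

/-- multiplicity data -/
lemma mult_mono (q : ℂ[X]) (hq : 2 ≤ q.natDegree) (m : ℕ) (hm : 0 < m) (b : ℂ)
    (hb : q.derivative.eval b ≠ 0) :
    ((q.comp^[m] X) - X).rootMultiplicity b ≤ ((q.comp^[m] X) - X).rootMultiplicity (q.eval b) := by
  obtain ⟨hne, -⟩ := iter_sub_X_ne q hq m hm
  refine le_trans ?_ (mult_comp_le _ q b hne hb)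
  have hd : (q.comp^[m] X) - X ∣ ((q.comp^[m] X) - X).comp q := by
    rw [sub_comp, X_comp, comp_iter_comm]; exact dvd_comp_sub _ _
  have hne' : ((q.comp^[m] X) - X).comp q ≠ 0 := by
    intro h
    rcases comp_eq_zero_iff.1 h with h | ⟨-, h⟩
    · exact hne h
    · rw [h] at hq; simp at hq
  exact rootMultiplicity_le_rootMultiplicity_of_dvd hne' hd b

lemma prod_pow_dvd (S : Finset ℂ) (k : ℂ → ℕ) (P : ℂ[X]) (h : ∀ b ∈ S, (X - C b) ^ k b ∣ P) :
    ∏ b ∈ S, (X - C b) ^ k b ∣ P := by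
  refine Finset.prod_dvd_of_coprime (fun a _ b _ hab => ?_) h
  exact IsCoprime.pow (isCoprime_X_sub_C_of_isUnit_sub (sub_ne_zero.2 hab).isUnit)

lemma coprime_prod (S : Finset ℂ) (k : ℂ → ℕ) (P : ℂ[X]) (h : ∀ b ∈ S, P.eval b ≠ 0) :
    IsCoprime P (∏ b ∈ S, (X - C b) ^ k b) := by
  refine IsCoprime.prod_right fun b hb => IsCoprime.pow_right ?_
  refine IsCoprime.symm ((irreducible_X_sub_C b).coprime_iff_not_dvd.2 ?_)
  rw [dvd_iff_isRoot]; exact h b hb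

lemma eval_prod_ne (S : Finset ℂ) (k : ℂ → ℕ) (z : ℂ) (hz : z ∉ S) :
    (∏ b ∈ S, (X - C b) ^ k b : ℂ[X]).eval z ≠ 0 := by
  rw [eval_prod]
  refine Finset.prod_ne_zero_iff.2 fun b hb => ?_
  rw [eval_pow]
  refine pow_ne_zero _ ?_
  simp only [eval_sub, eval_X, eval_C]
  exact sub_ne_zero.2 (fun h => hz (h ▸ hb))

/-- The analytic contradiction. -/
lemma no_transfer (q N : ℂ[X]) (m : ℕ) (hm : 0 < m) (hq : 2 ≤ q.natDegree) (S : Finset ℂ)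
    (hfix : ∀ b ∈ S, (q.comp^[m] X).eval b = b)
    (hlam : ∀ b ∈ S, ‖(q.comp^[m] X).derivative.eval b‖ ≤ 1)
    (k : ℂ → ℕ) (hk : ∀ b, k b = max 2 (((q.comp^[m] X) - X).rootMultiplicity b))
    (M : ℂ[X]) (hM : M = ∏ b ∈ S, (X - C b) ^ k b) (hN : N ≠ 0) (ζ : ℂ) (hζ : ‖ζ‖ = 1)
    (htr : ∀ x, M.eval x ≠ 0 → (∀ w, q.eval w = x → q.derivative.eval w ≠ 0) →
      ∃ s : Finset ℂ, (∀ w ∈ s, q.eval w = x ∧ q.derivative.eval w ≠ 0) ∧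
        ∑ w ∈ s, (q.derivative.eval w * N.eval w / M.eval w) / (q.derivative.eval w) ^ 2
          = ζ * (q.derivative.eval x * N.eval x / M.eval x)) : False := by
  set Q := q.comp^[m] X with hQ
  have hqd : q.derivative ≠ 0 := by
    intro h
    have := derivative_eq_zero.1 h
    omega
  have hMne : M ≠ 0 := by
    rw [hM]; exact Finset.prod_ne_zero_iff.2 fun b _ => pow_ne_zero _ (X_sub_C_ne_zero b)
  set h : ℂ → ℝ≥0∞ := fun z => ‖q.derivative.eval z * N.eval z / M.eval z‖ₑ with hh
  have hmeas : Measurable h := by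
    have h1 : Measurable fun z => q.derivative.eval z := q.derivative.continuous.measurable
    have h2 : Measurable fun z => N.eval z := N.continuous.measurable
    have h3 : Measurable fun z => M.eval z := M.continuous.measurable
    exact ((h1.mul h2).div h3).enorm
  have hpush1 : ∀ V, MeasurableSet V →
      ∫⁻ x in V, h x ≤ ∫⁻ x in (fun w => q.eval w) ⁻¹' V, h x := by
    intro V hV
    refine push_le q h hmeas
      ((M.roots.toFinset ∪ q.derivative.roots.toFinset.image (fun w => q.eval w) : Finset ℂ) : Set ℂ)
      ((Finset.finite_toSet _).measure_zero _) ?_ V hV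
    intro x hx
    simp only [Finset.coe_union, mem_union, Finset.mem_coe, not_or, Multiset.mem_toFinset,
      mem_roots hMne, Finset.mem_image, mem_roots hqd, not_exists, not_and, IsRoot.def] at hx
    obtain ⟨s, hs1, hs2⟩ := htr x hx.1 (fun w hw h0 => hx.2 w h0 hw)
    refine ⟨s, hs1, ?_⟩
    have : h x = ‖∑ w ∈ s, (q.derivative.eval w * N.eval w / M.eval w) / (q.derivative.eval w) ^ 2‖ₑ := by
      rw [hs2, enorm_mul]
      have : ‖ζ‖ₑ = 1 := by rw [← ofReal_norm, hζ]; simp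
      rw [this, one_mul]
    rw [this]
    refine (enorm_sum_le _ _).trans (Finset.sum_le_sum fun w hw => ?_)
    rw [div_eq_mul_inv _ (_ ^ 2), enorm_mul, enorm_inv (pow_ne_zero _ (hs1 w hw).2), enorm_pow,
      ← div_eq_mul_inv]
  have hpushm : ∀ j : ℕ, ∀ V, MeasurableSet V →
      ∫⁻ x in V, h x ≤ ∫⁻ x in (fun w => q.eval w)^[j] ⁻¹' V, h x := by
    intro j
    induction j with
    | zero => intro V _; simp
    | succ j ih =>
      intro V hV
      rw [Function.iterate_succ, preimage_comp]
      refine (ih V hV).trans (hpush1 _ ?_)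
      exact (q.continuous.measurable.iterate j) hV
  have hQe : (fun w => Q.eval w) = (fun w => q.eval w)^[m] := by
    funext w; exact iter_eval q m w
  obtain ⟨hne, hdeg⟩ := iter_sub_X_ne q hq m hm
  refine no_invariant Q ?_ h S k (fun b => ?_) (fun V hV => ?_) (fun b hb => ?_) ?_ ?_
  · rw [hQ, iter_natDegree]; exact hq.trans (Nat.le_self_pow hm.ne' _)
  · rw [hk]; exact le_max_left _ _
  · rw [hQe]; exact hpushm m V hV
  · -- local bounds
    obtain ⟨g, hg⟩ := linear_dvd Q b hne (hfix b hb)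
    rw [← hk b] at hg
    set M1 : ℂ[X] := ∏ a ∈ S.erase b, (X - C a) ^ k a with hM1
    have hMM : M = (X - C b) ^ k b * M1 := by rw [hM, hM1]; exact (Finset.mul_prod_erase S (fun a => (X - C a : ℂ[X]) ^ k a) hb).symm
    have hM1b : M1.eval b ≠ 0 := eval_prod_ne _ _ _ (by simp)
    have c1 : ContinuousAt (fun z => ‖q.derivative.eval z * N.eval z / M1.eval z‖) b := by
      refine ContinuousAt.norm (ContinuousAt.div ?_ M1.continuous.continuousAt hM1b)
      exact (q.derivative.continuous.mul N.continuous).continuousAt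
    have c2 : ContinuousAt (fun z => ‖g.eval z‖) b := g.continuous.norm.continuousAt
    set C0 : ℝ := max (‖q.derivative.eval b * N.eval b / M1.eval b‖) (‖g.eval b‖) + 1 with hC0
    have e1 := c1.eventually_lt_const (u := C0) (by
      rw [hC0]; exact lt_of_le_of_lt (le_max_left _ _) (lt_add_one _))
    have e2 := c2.eventually_lt_const (u := C0) (by
      rw [hC0]; exact lt_of_le_of_lt (le_max_right _ _) (lt_add_one _))
    obtain ⟨δ, hδ, hball⟩ := Metric.eventually_nhds_iff.1 (e1.and e2)
    have hC0p : 0 < C0 := lt_of_le_of_lt (norm_nonneg (g.eval b)) (e2.self_of_nhds)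
    refine ⟨C0, δ, hC0p, hδ, fun z hzb hz => ?_, fun z hz => ?_⟩
    · have h1 := (hball (y := z) (by rwa [dist_eq_norm])).1
      simp only [hh]
      rw [← ofReal_norm]
      refine ENNReal.ofReal_le_ofReal ?_
      have : q.derivative.eval z * N.eval z / M.eval z
          = q.derivative.eval z * N.eval z / M1.eval z / (z - b) ^ k b := by
        rw [hMM]; simp only [eval_mul, eval_pow, eval_sub, eval_X, eval_C]
        rw [div_div, mul_comm (M1.eval z)]
      rw [this, norm_div, norm_pow]
      gcongr
    · have h1 := (hball (y := z) (by rwa [dist_eq_norm])).2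
      have h2 := congrArg (fun p => p.eval z) hg
      simp only [eval_mul, eval_pow, eval_sub, eval_X, eval_C] at h2
      have h3 : Q.eval z - b = Q.derivative.eval b * (z - b) + (z - b) ^ k b * g.eval z := by
        rw [← h2]; ring
      rw [h3]
      refine (norm_add_le _ _).trans ?_
      rw [norm_mul, norm_mul, norm_pow]
      refine add_le_add ?_ ?_
      · exact mul_le_of_le_one_left (norm_nonneg _) (hlam b hb)
      · rw [mul_comm]; gcongr
  · -- finiteness on compacts
    intro ε R hε
    set K : Set ℂ := Metric.closedBall 0 R ∩ ⋂ b ∈ S, {z | ε ≤ ‖z - b‖} with hK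
    have hKc : IsCompact K := by
      refine (isCompact_closedBall _ _).inter_right (isClosed_biInter fun b _ => ?_)
      exact isClosed_le continuous_const (by fun_prop)
    have hcont : ContinuousOn (fun z => q.derivative.eval z * N.eval z / M.eval z) K := by
      refine ContinuousOn.div (q.derivative.continuous.mul N.continuous).continuousOn
        M.continuous.continuousOn fun z hz => ?_
      rw [hM]
      refine eval_prod_ne _ _ _ fun hzS => ?_
      have := mem_iInter₂.1 hz.2 z hzS
      simp at this; linarith
    obtain ⟨B, hB⟩ := hKc.exists_bound_of_continuousOn hcont
    refine ⟨B, fun z hz hzS => ?_⟩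
    simp only [hh]
    rw [← ofReal_norm]
    refine ENNReal.ofReal_le_ofReal (hB z ⟨?_, ?_⟩)
    · simpa using hz.le
    · exact mem_iInter₂.2 fun b hb => (hzS b hb).le
  · intro A hA hA0
    rw [lintegral_eq_zero_iff hmeas] at hA0
    have hfin : volume (((q.derivative * N * M).roots.toFinset : Finset ℂ) : Set ℂ) = 0 :=
      (Finset.finite_toSet _).measure_zero _
    have h1 : ∀ᵐ x ∂volume, x ∈ A → h x = 0 := by
      rw [Filter.EventuallyEq, ae_restrict_iff' hA] at hA0
      simpa using hA0
    refine measure_mono_null (t := {x | ¬ (x ∈ A → h x = 0)} ∪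
      (((q.derivative * N * M).roots.toFinset : Finset ℂ) : Set ℂ)) (fun x hx => ?_)
      (measure_union_null h1 hfin)
    by_cases hx0 : h x = 0
    · right
      simp only [hh, enorm_eq_zero, div_eq_zero_iff] at hx0
      simp [hqd, hN, hMne]
      simpa using hx0
    · left; simp [hx, hx0]

lemma count_nonrep (q : ℂ[X]) (m : ℕ) (hm : 0 < m) (hq : 2 ≤ q.natDegree) (S : Finset ℂ)
    (hS : ∀ b, b ∈ S ↔ (q.comp^[m] X).eval b = b ∧ (q.comp^[m] X).derivative.eval b ≠ 0 ∧
      ‖(q.comp^[m] X).derivative.eval b‖ ≤ 1) :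
    ∑ b ∈ S, (max 2 (((q.comp^[m] X) - X).rootMultiplicity b) - 1) ≤ (q.natDegree - 1) * m := by
  by_contra hcon
  rw [not_le] at hcon
  set Q := q.comp^[m] X with hQ
  set k : ℂ → ℕ := fun b => max 2 ((Q - X).rootMultiplicity b) with hk
  have hk2 : ∀ b, 2 ≤ k b := fun b => le_max_left _ _
  obtain ⟨hne, hdeg⟩ := iter_sub_X_ne q hq m hm
  set M : ℂ[X] := ∏ b ∈ S, (X - C b) ^ k b with hM
  set r : ℂ[X] := ∏ b ∈ S, (X - C b) ^ 1 with hr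
  have hMm : M.Monic := monic_prod_of_monic _ _ fun b _ => (monic_X_sub_C b).pow _
  have hrm : r.Monic := monic_prod_of_monic _ _ fun b _ => (monic_X_sub_C b).pow _
  have hMd : M.natDegree = ∑ b ∈ S, k b := by
    rw [hM, natDegree_prod_of_monic _ _ fun b _ => (monic_X_sub_C b).pow _]
    simp
  have hrd : r.natDegree = ∑ b ∈ S, 1 := by
    rw [hr, natDegree_prod_of_monic _ _ fun b _ => (monic_X_sub_C b).pow _]
    simp
  have hq' : ∀ b ∈ S, q.derivative.eval b ≠ 0 := by
    intro b hb h0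
    refine ((hS b).1 hb).2.1 ?_
    rw [hQ, iter_deriv]
    exact Finset.prod_eq_zero (i := 0) (by simpa using hm) (by simpa using h0)
  have hqS : ∀ b ∈ S, q.eval b ∈ S := by
    intro b hb
    have h1 := (hS b).1 hb
    have h2 : (fun w => q.eval w)^[m] b = b := by rw [← iter_eval]; exact h1.1
    have h3 := iter_deriv_step q m b h2
    rw [← hQ] at h3
    rw [hS, h3]
    refine ⟨?_, h1.2⟩
    rw [hQ, iter_eval, ← Function.iterate_succ_apply (fun w => q.eval w),
      Function.iterate_succ_apply', h2]
  have hdvd : M ∣ M.comp q := by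
    conv_lhs => rw [hM]
    refine prod_pow_dvd S k _ fun b hb => ?_
    have h1 : (X - C (q.eval b)) ^ k (q.eval b) ∣ M :=
      Finset.dvd_prod_of_mem (fun b => (X - C b : ℂ[X]) ^ k b) (hqS b hb)
    have h2 : (X - C b) ∣ (X - C (q.eval b)).comp q := by
      rw [dvd_iff_isRoot]; simp
    have h3 : k b ≤ k (q.eval b) := max_le_max le_rfl (mult_mono q hq m hm b (hq' b hb))
    refine (pow_dvd_pow _ h3).trans ((pow_dvd_pow_of_dvd h2 _).trans ?_)
    rw [← pow_comp]
    obtain ⟨u, hu⟩ := h1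
    exact ⟨u.comp q, by rw [← mul_comp, ← hu]⟩
  obtain ⟨ζ, hζ, μ, hμ, h1, h2, h3⟩ := exists_functional q M r m hm hq hMm hrm hdvd
    (coprime_prod S k _ hq') (coprime_prod S k _ fun b hb => ((hS b).1 hb).2.1)
    (fun φ => prod_pow_dvd S k _ fun b hb => wronski_dvd Q _ b hne ((hS b).1 hb).1
      (Dvd.dvd.mul_right (by
        have := Finset.dvd_prod_of_mem (fun b => (X - C b : ℂ[X]) ^ 1) hb
        simpa [hr] using this) _))
    (by
      rw [hMd, hrd]
      have : ∑ b ∈ S, k b = ∑ b ∈ S, (k b - 1) + ∑ b ∈ S, 1 := by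
        rw [← Finset.sum_add_distrib]
        refine Finset.sum_congr rfl fun b _ => ?_
        have := hk2 b; omega
      rw [this, Nat.add_sub_cancel]
      exact hcon)
  obtain ⟨N, hN, htr⟩ := transfer q M hq hMm hdvd μ h1 ζ h2 h3 hμ
  exact no_transfer q N m hm hq S (fun b hb => ((hS b).1 hb).1) (fun b hb => ((hS b).1 hb).2.2)
    k (fun b => rfl) M hM hN ζ hζ htr

lemma post_count (q : ℂ[X]) (m : ℕ) (hm : 0 < m) (hq : 2 ≤ q.natDegree) (T : Finset ℂ)
    (hT : ∀ r ∈ T, (fun w => q.eval w)^[m] r = r ∧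
      ∃ (n : ℕ) (c : ℂ), q.derivative.eval c = 0 ∧ (fun w => q.eval w)^[n + 1] c = r) :
    T.card ≤ (q.natDegree - 1) * m := by
  classical
  set F : ℂ → ℂ := fun w => q.eval w with hF
  have hqd : q.derivative ≠ 0 := by
    intro h
    have := derivative_eq_zero.1 h
    omega
  have key : ∀ c : ℂ, ∃ n0 : ℕ, ∀ n, F^[m] (F^[n] c) = F^[n] c →
      n0 ≤ n ∧ F^[m] (F^[n0] c) = F^[n0] c := by
    intro c
    by_cases h : ∃ n, F^[m] (F^[n] c) = F^[n] c
    · exact ⟨Nat.find h, fun n hn => ⟨Nat.find_min' h hn, Nat.find_spec h⟩⟩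
    · exact ⟨0, fun n hn => absurd ⟨n, hn⟩ h⟩
  choose n0 hn0 using key
  have hsub : T ⊆ q.derivative.roots.toFinset.biUnion
      (fun c => (Finset.range m).image (fun i => F^[i] (F^[n0 c] c))) := by
    intro r hr
    obtain ⟨h1, n, c, hc, hnc⟩ := hT r hr
    obtain ⟨h2, h3⟩ := hn0 c (n + 1) (by rw [hnc, h1])
    rw [Finset.mem_biUnion]
    refine ⟨c, by simp [hqd, hc], ?_⟩
    rw [Finset.mem_image]
    refine ⟨(n + 1 - n0 c) % m, by simpa using Nat.mod_lt _ hm, ?_⟩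
    have h4 : Function.IsPeriodicPt F m (F^[n0 c] c) := h3
    rw [h4.iterate_mod_apply, ← Function.iterate_add_apply, Nat.sub_add_cancel h2, hnc]
  refine (Finset.card_le_card hsub).trans (Finset.card_biUnion_le.trans ?_)
  refine (Finset.sum_le_card_nsmul _ _ m (fun c _ =>
    Finset.card_image_le.trans (by simp))).trans ?_
  rw [smul_eq_mul]
  refine Nat.mul_le_mul_right _ ?_
  refine (Multiset.toFinset_card_le _).trans ((card_roots' _).trans ?_)
  exact natDegree_derivative_le q

lemma crit_post (q : ℂ[X]) (m : ℕ) (r : ℂ) (hr : (fun w => q.eval w)^[m] r = r)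
    (h0 : (q.comp^[m] X).derivative.eval r = 0) :
    ∃ (n : ℕ) (c : ℂ), q.derivative.eval c = 0 ∧ (fun w => q.eval w)^[n + 1] c = r := by
  rw [iter_deriv, Finset.prod_eq_zero_iff] at h0
  obtain ⟨i, hi, h⟩ := h0
  rw [Finset.mem_range] at hi
  refine ⟨m - i - 1, _, h, ?_⟩
  rw [← Function.iterate_add_apply, show m - i - 1 + 1 + i = m by omega, hr]

lemma two_pow_gt (n : ℕ) (hn : 5 ≤ n) : 3 * (n + 1) < 2 ^ n := by
  induction n, hn using Nat.le_induction with
  | base => norm_num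
  | succ n hn ih => rw [pow_succ]; omega

lemma exists_good (q c : ℂ[X]) (m : ℕ) (hm : 6 ≤ m) (hq : 2 ≤ q.natDegree) (hc : c ≠ 0)
    (hcd : c.natDegree ≤ q.natDegree ^ (m - 1)) :
    ∃ r : ℂ, (fun w => q.eval w)^[m] r = r ∧ 1 < ‖(q.comp^[m] X).derivative.eval r‖ ∧
      (¬ ∃ (n : ℕ) (c : ℂ), q.derivative.eval c = 0 ∧ (fun w => q.eval w)^[n + 1] c = r) ∧
      c.eval r ≠ 0 := by
  classical
  by_contra hcon
  push Not at hcon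
  have hm0 : 0 < m := by omega
  obtain ⟨hne, hdeg⟩ := iter_sub_X_ne q hq m hm0
  set Q := q.comp^[m] X with hQ
  set Z := (Q - X).roots.toFinset with hZ
  set S := Z.filter (fun b => Q.derivative.eval b ≠ 0 ∧ ‖Q.derivative.eval b‖ ≤ 1) with hSdef
  set T := Z.filter (fun r => ∃ (n : ℕ) (c : ℂ), q.derivative.eval c = 0 ∧
    (fun w => q.eval w)^[n + 1] c = r) with hTdef
  set K := c.roots.toFinset with hK
  have hZm : ∀ b, b ∈ Z ↔ Q.eval b = b := fun b => by
    rw [hZ, Multiset.mem_toFinset, mem_roots hne]; simp [sub_eq_zero]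
  have hA := count_nonrep q m hm0 hq S (fun b => by
    rw [hSdef, Finset.mem_filter, hZm])
  rw [← hQ] at hA
  have hB := post_count q m hm0 hq T (fun r hr => by
    rw [hTdef, Finset.mem_filter, hZm, hQ, iter_eval] at hr; exact hr)
  have hC : K.card ≤ q.natDegree ^ (m - 1) :=
    (Multiset.toFinset_card_le _).trans ((card_roots' _).trans hcd)
  have hsum : ∑ b ∈ Z, (Q - X).rootMultiplicity b = q.natDegree ^ m := by
    rw [← hdeg, (IsAlgClosed.splits (Q - X)).natDegree_eq_card_roots,
      ← Multiset.toFinset_sum_count_eq]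
    exact Finset.sum_congr rfl fun b _ => (count_roots _).symm
  have hpt : ∀ b ∈ Z, (Q - X).rootMultiplicity b ≤
      (if b ∈ S then 2 * (max 2 ((Q - X).rootMultiplicity b) - 1) else 0)
        + (if b ∈ T then 1 else 0) + (if b ∈ K then 1 else 0) := by
    intro b hb
    by_cases hbS : b ∈ S
    · rw [if_pos hbS]; omega
    · have hQb := (hZm b).1 hb
      have hFb : (fun w => q.eval w)^[m] b = b := by rw [← iter_eval]; exact hQb
      have hν : (Q - X).rootMultiplicity b ≤ 1 := by
        by_contra h
        rw [not_le] at h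
        have h2 := ((one_lt_rootMultiplicity_iff_isRoot hne).1 h).2
        have h3 : Q.derivative.eval b = 1 := by simpa [IsRoot, sub_eq_zero] using h2
        exact hbS (by rw [hSdef, Finset.mem_filter]; exact ⟨hb, by simp [h3], by simp [h3]⟩)
      have hor : b ∈ T ∨ b ∈ K := by
        by_cases h0 : Q.derivative.eval b = 0
        · left; rw [hTdef, Finset.mem_filter]
          exact ⟨hb, crit_post q m b hFb h0⟩
        · have h1 : 1 < ‖Q.derivative.eval b‖ := by
            by_contra h
            exact hbS (by rw [hSdef, Finset.mem_filter]; exact ⟨hb, h0, not_lt.1 h⟩)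
          by_cases hT : b ∈ T
          · exact Or.inl hT
          · right
            rw [hTdef, Finset.mem_filter, not_and] at hT
            have hT' := hT hb
            push Not at hT'
            have := hcon b hFb h1 hT'
            rw [hK, Multiset.mem_toFinset, mem_roots hc]; exact this
      rcases hor with h | h
      · rw [if_pos h]; omega
      · rw [if_pos h]; omega
  have htot := Finset.sum_le_sum hpt
  rw [hsum, Finset.sum_add_distrib, Finset.sum_add_distrib] at htot
  have s1 : ∑ b ∈ Z, (if b ∈ S then 2 * (max 2 ((Q - X).rootMultiplicity b) - 1) else 0)
      = 2 * ∑ b ∈ S, (max 2 ((Q - X).rootMultiplicity b) - 1) := by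
    rw [← Finset.sum_filter, Finset.mul_sum]
    refine Finset.sum_congr ?_ fun _ _ => rfl
    ext b; simp only [Finset.mem_filter, hSdef]; tauto
  have s2 : ∑ b ∈ Z, (if b ∈ T then 1 else 0) ≤ T.card := by
    rw [← Finset.sum_filter, ← Finset.card_eq_sum_ones]
    refine Finset.card_le_card fun b hb => (Finset.mem_filter.1 hb).2
  have s3 : ∑ b ∈ Z, (if b ∈ K then 1 else 0) ≤ K.card := by
    rw [← Finset.sum_filter, ← Finset.card_eq_sum_ones]
    refine Finset.card_le_card fun b hb => (Finset.mem_filter.1 hb).2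
  rw [s1] at htot
  obtain ⟨n, rfl⟩ : ∃ n, m = n + 1 := ⟨m - 1, by omega⟩
  obtain ⟨e, he⟩ : ∃ e, q.natDegree = e + 1 := ⟨q.natDegree - 1, by omega⟩
  have h5 := two_pow_gt n (by omega)
  have h6 : 2 ^ n ≤ q.natDegree ^ n := Nat.pow_le_pow_left hq n
  simp only [Nat.add_sub_cancel, he] at *
  rw [pow_succ] at htot
  nlinarith

lemma c_poly (q : ℂ[X]) (m : ℕ) (hm : 0 < m) (hq : 2 ≤ q.natDegree) (b : ℕ → ℂ)
    (hb : ∀ i, b i ≠ 0) :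
    (∑ i ∈ Finset.range m, C (b i) * q.comp^[i] X) ≠ 0 ∧
    (∑ i ∈ Finset.range m, C (b i) * q.comp^[i] X).natDegree ≤ q.natDegree ^ (m - 1) := by
  obtain ⟨n, rfl⟩ : ∃ n, m = n + 1 := ⟨m - 1, by omega⟩
  have hd : ∀ i, (C (b i) * q.comp^[i] X).natDegree = q.natDegree ^ i := fun i => by
    rw [natDegree_C_mul (hb i), iter_natDegree]
  have hle : ∀ s, (∑ i ∈ Finset.range (s + 1), C (b i) * q.comp^[i] X).natDegree
      ≤ q.natDegree ^ s := fun s => by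
    refine natDegree_sum_le_of_forall_le _ _ fun i hi => ?_
    rw [hd]
    exact Nat.pow_le_pow_right (by omega) (by simp at hi; omega)
  refine ⟨?_, hle n⟩
  rcases n with _ | n
  · simp [hb]
  · intro h
    rw [Finset.sum_range_succ] at h
    have h1 : (∑ i ∈ Finset.range (n + 1), C (b i) * q.comp^[i] X).natDegree
        < (C (b (n + 1)) * q.comp^[n + 1] X).natDegree := by
      rw [hd]
      exact (hle n).trans_lt (Nat.pow_lt_pow_right (by omega) (by omega))
    have h2 := natDegree_add_eq_right_of_natDegree_lt h1
    rw [h] at h2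
    rw [← h2] at h1
    simp at h1

lemma c_step (F : ℂ → ℂ) (m₀ : ℕ) (ρ : ℂ) (hρ3 : ρ ^ 3 = 1) (b : ℤ → ℂ)
    (hb : ∀ i : ℤ, b (i - m₀) = ρ * b i) (x : ℂ) (hx : F^[3 * m₀] x = x) :
    (∑ i ∈ Finset.range (3 * m₀), b i * F^[i] (F^[m₀] x)) =
      ρ * ∑ i ∈ Finset.range (3 * m₀), b i * F^[i] x := by
  have hper : ∀ i : ℤ, b (i + 3 * m₀) = b i := fun i => by
    have h1 := hb (i + m₀)
    have h2 := hb (i + 2 * m₀)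
    have h3 := hb (i + 3 * m₀)
    rw [show i + (m₀ : ℤ) - m₀ = i by ring] at h1
    rw [show i + 2 * (m₀ : ℤ) - m₀ = i + m₀ by ring] at h2
    rw [show i + 3 * (m₀ : ℤ) - m₀ = i + 2 * m₀ by ring] at h3
    rw [h1, h2, h3]
    linear_combination (-b (i + 3 * m₀)) * hρ3
  set g : ℕ → ℂ := fun j => b j * F^[j] x with hg
  have e1 := Finset.sum_range_add g m₀ (3 * m₀)
  have e2 := Finset.sum_range_add g (3 * m₀) m₀
  have e3 : ∑ i ∈ Finset.range m₀, g (3 * m₀ + i) = ∑ i ∈ Finset.range m₀, g i := by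
    refine Finset.sum_congr rfl fun i _ => ?_
    simp only [hg]
    rw [show 3 * m₀ + i = i + 3 * m₀ by ring, Function.iterate_add_apply, hx]
    push_cast
    rw [hper]
  rw [add_comm m₀ (3 * m₀)] at e1
  have e4 : ∑ i ∈ Finset.range (3 * m₀), g (m₀ + i) = ∑ i ∈ Finset.range (3 * m₀), g i := by
    rw [e3] at e2
    rw [e1] at e2
    linear_combination e2
  change _ = ρ * ∑ i ∈ Finset.range (3 * m₀), g i
  rw [← e4, Finset.mul_sum]
  refine Finset.sum_congr rfl fun i _ => ?_
  simp only [hg]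
  have h1 := hb (i + m₀)
  rw [show (i : ℤ) + (m₀ : ℤ) - m₀ = i by ring] at h1
  rw [h1, ← Function.iterate_add_apply, add_comm m₀ i]
  push_cast
  ring

lemma not_coll (ρ c : ℂ) (hρ : ρ ^ 2 + ρ + 1 = 0) (hρ1 : ρ ≠ 1) (hc : c ≠ 0) :
    ¬ Collinear ℝ ({c, ρ * c, ρ ^ 2 * c} : Set ℂ) := by
  intro h
  obtain ⟨v, hv⟩ := (collinear_iff_of_mem (p₀ := c) (by simp)).1 h
  obtain ⟨t, ht⟩ := hv (ρ * c) (by simp)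
  obtain ⟨s, hs⟩ := hv (ρ ^ 2 * c) (by simp)
  simp only [vadd_eq_add, Complex.real_smul] at ht hs
  have h1 : (ρ - 1) * c * ((t : ℂ) * (ρ + 1) - s) = 0 := by
    linear_combination (t : ℂ) * hs - (s : ℂ) * ht
  have h2 : (t : ℂ) * (ρ + 1) - s = 0 := by
    rcases mul_eq_zero.1 h1 with h | h
    · exact absurd h (mul_ne_zero (sub_ne_zero.2 hρ1) hc)
    · exact h
  have ht0 : t ≠ 0 := by
    rintro rfl
    apply mul_ne_zero (sub_ne_zero.2 hρ1) hc
    push_cast at ht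
    linear_combination ht
  have h3 := congrArg Complex.im h2
  simp [ht0] at h3
  have h4 := congrArg Complex.re hρ
  simp [pow_two, h3] at h4
  nlinarith [sq_nonneg (ρ.re + 1 / 2)]

lemma iter_deriv_steps (q : ℂ[X]) (m j : ℕ) (x : ℂ) (hx : (fun w => q.eval w)^[m] x = x) :
    (fun w => q.eval w)^[m] ((fun w => q.eval w)^[j] x) = (fun w => q.eval w)^[j] x ∧
    (q.comp^[m] X).derivative.eval ((fun w => q.eval w)^[j] x) =
      (q.comp^[m] X).derivative.eval x := by
  have h1 : ∀ j, (fun w => q.eval w)^[m] ((fun w => q.eval w)^[j] x)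
      = (fun w => q.eval w)^[j] x := fun j => by
    rw [← Function.iterate_add_apply, add_comm, Function.iterate_add_apply, hx]
  refine ⟨h1 j, ?_⟩
  induction j with
  | zero => simp
  | succ j ih =>
    rw [Function.iterate_succ_apply', iter_deriv_step q m _ (h1 j), ih]

lemma deriv_iter (q : ℂ[X]) (m : ℕ) (x : ℂ) :
    deriv ((fun w => q.eval w)^[m]) x = (q.comp^[m] X).derivative.eval x := by
  rw [← Polynomial.deriv]
  congr 1
  funext w
  exact (iter_eval q m w).symm

end Helpers

/-- Lemma 4.4: let `q` have degree `d ≥ 2`, `m₀ ≥ 2`, `m₁ = 3 m₀`, `ρ` a primitive third root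
of unity and `b : ℤ → ℂ ∖ {0}` with `b_{i-m₀} = ρ bᵢ`. Setting `c(w) = ∑_{i<m₁} bᵢ q^i(w)`,
there is a repelling point `r` of period `m₁` outside the postcritical set with `c(r) ≠ 0`;
moreover the points `r₁ = r`, `r₂ = q^{m₀}(r)`, `r₃ = q^{2m₀}(r)` are pairwise distinct repelling
fixed points of `q^{m₁}` outside the postcritical set, and `c₂ = ρ c₁`, `c₃ = ρ² c₁`, so that
`c₁, c₂, c₃` form a non-degenerate equilateral triangle: they are non-collinear and sum to `0`. -/
theorem stmt_10 (d : ℕ) (hd : 2 ≤ d) (m₀ : ℕ) (hm₀ : 2 ≤ m₀)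
    (q : Polynomial ℂ) (hq : q.natDegree = d)
    (ρ : ℂ) (hρ3 : ρ ^ 3 = 1) (hρ1 : ρ ≠ 1)
    (b : ℤ → ℂ) (hb0 : ∀ i, b i ≠ 0) (hb : ∀ i : ℤ, b (i - m₀) = ρ * b i) :
    ∃ r : ℂ,
      (fun w => q.eval w)^[3 * m₀] r = r ∧
      1 < ‖deriv ((fun w => q.eval w)^[3 * m₀]) r‖ ∧
      r ∉ (⋃ n : ℕ, (fun w => q.eval w)^[n + 1] '' {w : ℂ | q.derivative.eval w = 0}) ∧
      (∑ i ∈ Finset.range (3 * m₀), b i * (fun w => q.eval w)^[i] r) ≠ 0 ∧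
      (let r₁ : ℂ := r
       let r₂ : ℂ := (fun w => q.eval w)^[m₀] r
       let r₃ : ℂ := (fun w => q.eval w)^[2 * m₀] r
       let c : ℂ → ℂ := fun x => ∑ i ∈ Finset.range (3 * m₀), b i * (fun w => q.eval w)^[i] x
       r₁ ≠ r₂ ∧ r₁ ≠ r₃ ∧ r₂ ≠ r₃ ∧
       (∀ x ∈ ({r₁, r₂, r₃} : Set ℂ),
          (fun w => q.eval w)^[3 * m₀] x = x ∧
          1 < ‖deriv ((fun w => q.eval w)^[3 * m₀]) x‖ ∧
          x ∉ (⋃ n : ℕ, (fun w => q.eval w)^[n + 1] '' {w : ℂ | q.derivative.eval w = 0})) ∧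
       c r₂ = ρ * c r₁ ∧ c r₃ = ρ ^ 2 * c r₁ ∧
       ¬ Collinear ℝ ({c r₁, c r₂, c r₃} : Set ℂ) ∧
       c r₁ + c r₂ + c r₃ = 0) := by
  classical
  subst hq
  have hm : 6 ≤ 3 * m₀ := by omega
  set F : ℂ → ℂ := fun w => q.eval w with hF
  have hρ : ρ ^ 2 + ρ + 1 = 0 := by
    have : (ρ - 1) * (ρ ^ 2 + ρ + 1) = 0 := by linear_combination hρ3
    rcases mul_eq_zero.1 this with h | h
    · exact absurd (sub_eq_zero.1 h) hρ1
    · exact h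
  obtain ⟨hc0, hcd⟩ := c_poly q (3 * m₀) (by omega) hd (fun i => b i) (fun i => hb0 i)
  obtain ⟨r, hr1, hr2, hr3, hr4⟩ := exists_good q _ (3 * m₀) hm hd hc0 hcd
  rw [← hF] at hr1
  have hcr : (∑ i ∈ Finset.range (3 * m₀), b i * F^[i] r) ≠ 0 := by
    rw [Polynomial.eval_finsetSum] at hr4
    simpa only [Polynomial.eval_mul, Polynomial.eval_C, iter_eval] using hr4
  have horb : ∀ j, j ≤ 3 * m₀ → F^[3 * m₀] (F^[j] r) = F^[j] r ∧
      1 < ‖deriv (F^[3 * m₀]) (F^[j] r)‖ ∧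
      F^[j] r ∉ (⋃ n : ℕ, F^[n + 1] '' {w : ℂ | q.derivative.eval w = 0}) := by
    intro j hj
    obtain ⟨h1, h2⟩ := iter_deriv_steps q (3 * m₀) j r hr1
    refine ⟨h1, ?_, ?_⟩
    · rw [hF, deriv_iter, h2]; exact hr2
    · intro hmem
      obtain ⟨n, c, hc, hcn⟩ := Set.mem_iUnion.1 hmem
      refine hr3 ⟨3 * m₀ - j + n, c, hc, ?_⟩
      rw [← hF, show 3 * m₀ - j + n + 1 = (3 * m₀ - j) + (n + 1) by ring,
        Function.iterate_add_apply, hcn, ← Function.iterate_add_apply, Nat.sub_add_cancel hj, hr1]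
  have o0 := horb 0 (by omega)
  have o1 := horb m₀ (by omega)
  have o2 := horb (2 * m₀) (by omega)
  have hc1 := c_step F m₀ ρ hρ3 b hb r hr1
  have hc2 := c_step F m₀ ρ hρ3 b hb _ o1.1
  rw [hc1, ← Function.iterate_add_apply, ← two_mul, ← mul_assoc, ← pow_two] at hc2
  rw [Function.iterate_zero, id] at o0
  refine ⟨r, o0.1, o0.2.1, o0.2.2, hcr, ?_⟩
  intro r₁ r₂ r₃ c
  have g1 : c r₂ = ρ * c r₁ := hc1
  have g2 : c r₃ = ρ ^ 2 * c r₁ := hc2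
  have g0 : c r₁ ≠ 0 := hcr
  have hρ0 : ρ ≠ 0 := by rintro rfl; norm_num at hρ3
  refine ⟨?_, ?_, ?_, ?_, g1, g2, ?_, ?_⟩
  · intro h
    rw [← h] at g1
    have : (ρ - 1) * c r₁ = 0 := by linear_combination -g1
    exact mul_ne_zero (sub_ne_zero.2 hρ1) g0 this
  · intro h
    rw [← h] at g2
    have h3 : (ρ - 1) * c r₁ = 0 := by linear_combination ρ * g2 + c r₁ * hρ3
    exact mul_ne_zero (sub_ne_zero.2 hρ1) g0 h3
  · intro h
    rw [← h, g1] at g2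
    have h3 : ρ * ((ρ - 1) * c r₁) = 0 := by linear_combination -g2
    exact mul_ne_zero hρ0 (mul_ne_zero (sub_ne_zero.2 hρ1) g0) h3
  · rintro x (rfl | rfl | rfl)
    · exact o0
    · exact o1
    · exact o2
  · rw [g1, g2]
    exact not_coll ρ (c r₁) hρ hρ1 g0
  · rw [g1, g2]; linear_combination (c r₁) * hρ
end
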